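/- If φ, ρ, ψ are Royden inner functions on Ω with GCD(φ,ρ) = 1 and φ divides ρψ (in the sense that ρψ ∈ φ H¹(Ω)), then φ divides ψ. -/

import Mathlib

open MeasureTheory Metric Complex Filter Set
open scoped ENNReal Topology

noncomputable section

/-- `u` is harmonic (real-valued) on an open set `U ⊆ ℂ`: locally the real part of a
holomorphic function. -/
def IsHarmonicOn (u : ℂ → ℝ) (U : Set ℂ) : Prop :=
  ∀ z ∈ U, ∃ r > 0, ball z r ⊆ U ∧ ∃ g : ℂ → ℂ,
    DifferentiableOn ℂ g (ball z r) ∧ ∀ w ∈ ball z r, u w = (g w).re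

/-- An analytic boundary curve: the image of an injective analytic immersion of the
unit circle. -/
def IsAnalyticCurve (C : Set ℂ) : Prop :=
  ∃ γ : ℂ → ℂ, AnalyticOnNhd ℂ γ (sphere (0:ℂ) 1) ∧ Set.InjOn γ (sphere (0:ℂ) 1) ∧
    γ '' (sphere (0:ℂ) 1) = C ∧ ∀ z ∈ sphere (0:ℂ) 1, deriv γ z ≠ 0

/-- Nontangential limit `L` of `g` at a boundary point `ζ` of `Ω`: convergence within
every cone-like approach region of aperture `a > 1`. -/
def NTLim (Ω : Set ℂ) (g : ℂ → ℂ) (ζ : ℂ) (L : ℂ) : Prop :=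
  ∀ a : ℝ, 1 < a →
    Tendsto g (𝓝[{z ∈ Ω | ‖z - ζ‖ < a * infDist z Ωᶜ}] ζ) (𝓝 L)

/-- A bounded finitely connected planar domain `Ω` with analytic boundary components
`Γ 0, …, Γ n` (`Γ 0` the outer one), a base point `w₀ ∈ Ω`, and the family of harmonic
measures `ωm w` (probability measures on the boundary reproducing functions harmonic on
`Ω` and continuous on its closure). -/
structure MCDomain (n : ℕ) where
  Ω : Set ℂ
  Γ : Fin (n+1) → Set ℂ
  w₀ : ℂ
  ωm : ℂ → Measure ℂ
  isOpen : IsOpen Ω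
  conn : IsConnected Ω
  bdd : Bornology.IsBounded Ω
  base_mem : w₀ ∈ Ω
  frontier_eq : frontier Ω = ⋃ j, Γ j
  disj : ∀ j k, j ≠ k → Disjoint (Γ j) (Γ k)
  curve : ∀ j, IsAnalyticCurve (Γ j)
  outer_comp : ∀ j, j ≠ 0 → ∀ ζ ∈ Γ j, ζ ∈ closure (interior (closure (Ω ∪ Γ 0)))
  prob : ∀ w ∈ Ω, IsProbabilityMeasure (ωm w)
  supp : ∀ w ∈ Ω, ωm w (frontier Ω)ᶜ = 0
  dirichlet : ∀ u : ℂ → ℝ, ContinuousOn u (closure Ω) → IsHarmonicOn u Ω →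
    ∀ w ∈ Ω, u w = ∫ ζ, u ζ ∂(ωm w)

variable {n : ℕ}

/-- Harmonic measure at the base point. -/
def MCDomain.ω (D : MCDomain n) : Measure ℂ := D.ωm D.w₀

/-- `H^∞(Γ)`: boundary functions (via nontangential limits a.e.) of bounded analytic
functions on `Ω`. -/
def MCDomain.Hinf (D : MCDomain n) : Set (ℂ → ℂ) :=
  {ψ | ∃ g : ℂ → ℂ, DifferentiableOn ℂ g D.Ω ∧ (∃ C : ℝ, ∀ z ∈ D.Ω, ‖g z‖ ≤ C) ∧
    ∀ᵐ ζ ∂D.ω, NTLim D.Ω g ζ (ψ ζ)}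

/-- `H²(Γ)`: boundary functions of analytic functions on `Ω` such that `|g|²` has a
harmonic majorant. -/
def MCDomain.H2 (D : MCDomain n) : Set (ℂ → ℂ) :=
  {ψ | ∃ g : ℂ → ℂ, DifferentiableOn ℂ g D.Ω ∧
    (∃ h : ℂ → ℝ, IsHarmonicOn h D.Ω ∧ ∀ z ∈ D.Ω, ‖g z‖ ^ 2 ≤ h z) ∧
    ∀ᵐ ζ ∂D.ω, NTLim D.Ω g ζ (ψ ζ)}

/-- `H¹(Γ)`: boundary functions of analytic functions on `Ω` such that `|g|` has a
harmonic majorant. -/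
def MCDomain.H1 (D : MCDomain n) : Set (ℂ → ℂ) :=
  {ψ | ∃ g : ℂ → ℂ, DifferentiableOn ℂ g D.Ω ∧
    (∃ h : ℂ → ℝ, IsHarmonicOn h D.Ω ∧ ∀ z ∈ D.Ω, ‖g z‖ ≤ h z) ∧
    ∀ᵐ ζ ∂D.ω, NTLim D.Ω g ζ (ψ ζ)}

/-- `ψ` is (the boundary function of) an outer function on `Ω` in Royden's sense:
`log|g(w)| = ∫_Γ log|ψ| dω_w` for all `w ∈ Ω`. -/
def MCDomain.IsOuter (D : MCDomain n) (ψ : ℂ → ℂ) : Prop :=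
  ∃ g : ℂ → ℂ, DifferentiableOn ℂ g D.Ω ∧ (∀ᵐ ζ ∂D.ω, NTLim D.Ω g ζ (ψ ζ)) ∧
    ∀ w ∈ D.Ω, Real.log ‖g w‖ = ∫ ζ, Real.log ‖ψ ζ‖ ∂(D.ωm w)

/-- Royden inner function (boundary form): a member of `H^∞(Γ)` whose modulus is
a.e. constant on each boundary component. -/
def MCDomain.IsInner (D : MCDomain n) (φ : ℂ → ℂ) : Prop :=
  φ ∈ D.Hinf ∧ ∀ j, ∃ c : ℝ, ∀ᵐ ζ ∂D.ω, ζ ∈ D.Γ j → ‖φ ζ‖ = c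

/-! ### Curves parametrised on an annulus -/

/-- The open annulus `r < ‖z‖ < R`. -/
def openAnnulus (r R : ℝ) : Set ℂ := {z | r < ‖z‖ ∧ ‖z‖ < R}

lemma isOpen_openAnnulus (r R : ℝ) : IsOpen (openAnnulus r R) :=
  (isOpen_lt continuous_const continuous_norm).inter (isOpen_lt continuous_norm continuous_const)

lemma isPreconnected_openAnnulus {r R : ℝ} (hr : 0 ≤ r) :
    IsPreconnected (openAnnulus r R) := by
  have : openAnnulus r R =
      (fun p : ℝ × ℝ => (p.1 : ℂ) * exp (p.2 * I)) '' (Ioo r R ×ˢ univ) := by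
    ext z
    constructor
    · intro hz
      exact ⟨(‖z‖, arg z), ⟨⟨hz.1, hz.2⟩, mem_univ _⟩, norm_mul_exp_arg_mul_I z⟩
    · rintro ⟨⟨s, t⟩, ⟨hs, -⟩, rfl⟩
      have hs0 : 0 ≤ s := hr.trans hs.1.le
      simpa [openAnnulus, norm_exp_ofReal_mul_I, abs_of_nonneg hs0] using hs
  rw [this]
  refine (isPreconnected_Ioo.prod isPreconnected_univ).image _ ?_
  fun_prop

lemma openAnnulus_mono {r r' R R' : ℝ} (hr : r' ≤ r) (hR : R ≤ R') :
    openAnnulus r R ⊆ openAnnulus r' R' :=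
  fun _ hz => ⟨hr.trans_lt hz.1, hz.2.trans_le hR⟩

lemma sphere_subset_openAnnulus {r R s : ℝ} (hr : r < s) (hR : s < R) :
    sphere (0 : ℂ) s ⊆ openAnnulus r R := by
  intro z hz
  rw [mem_sphere_zero_iff_norm] at hz
  exact ⟨by rwa [hz], by rwa [hz]⟩

/-- Every neighbourhood of the unit circle contains an annulus. -/
lemma exists_openAnnulus_subset {U : Set ℂ} (hU : U ∈ 𝓝ˢ (sphere (0 : ℂ) 1)) :
    ∃ R : ℝ, 1 < R ∧ openAnnulus R⁻¹ R ⊆ U := by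
  obtain ⟨V, hVo, hSV, hVU⟩ := mem_nhdsSet_iff_exists.1 hU
  obtain ⟨δ, hδ, hδV⟩ := (isCompact_sphere (0 : ℂ) 1).exists_thickening_subset_open hVo hSV
  refine ⟨1 + min δ 1, by simp [hδ], fun z hz => hVU (hδV ?_)⟩
  have hm : 0 < min δ 1 := by simp [hδ]
  have h1 : ‖z‖ < 1 + min δ 1 := hz.2
  have h2 : (1 + min δ 1)⁻¹ < ‖z‖ := hz.1
  have h0 : 0 < ‖z‖ := lt_trans (by positivity) h2
  have h3 : 1 - min δ 1 < (1 + min δ 1)⁻¹ := by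
    rw [← one_div, lt_div_iff₀ (by positivity)]; nlinarith
  rw [mem_thickening_iff]
  refine ⟨z / ‖z‖, by simp [h0.ne'], ?_⟩
  have : z - z / ‖z‖ = z / ‖z‖ * ((‖z‖ - 1 : ℝ) : ℂ) := by
    have : (‖z‖ : ℂ) ≠ 0 := by exact_mod_cast h0.ne'
    push_cast
    field_simp
  rw [dist_eq_norm, this, norm_mul, norm_div, norm_real, norm_real, norm_norm, div_self h0.ne',
    one_mul, Real.norm_eq_abs, abs_lt]
  have := min_le_left δ 1
  constructor <;> linarith

/-- Circle integrals of a function holomorphic on an annulus do not depend on the radius. -/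
lemma circleIntegral_eq_of_differentiableOn_openAnnulus {r R s t : ℝ} (hr : 0 ≤ r) {f : ℂ → ℂ}
    (hf : DifferentiableOn ℂ f (openAnnulus r R)) (hs : r < s) (hst : s ≤ t) (ht : t < R) :
    (∮ z in C(0, t), f z) = ∮ z in C(0, s), f z := by
  have hsub : closedBall (0 : ℂ) t \ ball 0 s ⊆ openAnnulus r R := by
    intro z hz
    simp only [Set.mem_sdiff, mem_closedBall, mem_ball, dist_zero_right, not_lt] at hz
    exact ⟨by linarith [hz.2], by linarith [hz.1]⟩
  refine circleIntegral_eq_of_differentiable_on_annulus_off_countable (hr.trans_lt hs) hst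
    countable_empty (hf.continuousOn.mono hsub) fun z hz => ?_
  refine hf.differentiableAt ((isOpen_openAnnulus r R).mem_nhds (hsub ?_))
  exact ⟨ball_subset_closedBall hz.1.1, fun h => hz.1.2 (ball_subset_closedBall h)⟩

/-- `γ` is a conformal embedding of an annulus. -/
structure IsAnnulusEmbedding (γ : ℂ → ℂ) (r R : ℝ) : Prop where
  diff : DifferentiableOn ℂ γ (openAnnulus r R)
  inj : InjOn γ (openAnnulus r R)
  deriv_ne : ∀ z ∈ openAnnulus r R, deriv γ z ≠ 0

lemma IsAnnulusEmbedding.differentiableOn_deriv {γ : ℂ → ℂ} {r R : ℝ}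
    (h : IsAnnulusEmbedding γ r R) : DifferentiableOn ℂ (deriv γ) (openAnnulus r R) :=
  h.diff.deriv (isOpen_openAnnulus r R)

/-- Residue formula: the Cauchy kernel of `γ` integrated over the two boundary circles. -/
lemma IsAnnulusEmbedding.circleIntegral_sub {γ h : ℂ → ℂ} {r R s t : ℝ}
    (hγ : IsAnnulusEmbedding γ r R) (hr : 0 ≤ r) (hh : DifferentiableOn ℂ h (openAnnulus r R))
    {τ : ℂ} (hs : r < s) (hsτ : s < ‖τ‖) (hτt : ‖τ‖ < t) (ht : t < R) :
    (∮ z in C(0, t), h z * deriv γ z / (γ z - γ τ)) -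
      (∮ z in C(0, s), h z * deriv γ z / (γ z - γ τ)) = 2 * Real.pi * I * h τ := by
  have hO := isOpen_openAnnulus r R
  have hτ : τ ∈ openAnnulus r R := ⟨hs.trans hsτ, hτt.trans ht⟩
  have hs0 : 0 < s := hr.trans_lt hs
  have hD : DifferentiableOn ℂ (dslope γ τ) (openAnnulus r R) :=
    (differentiableOn_dslope (hO.mem_nhds hτ)).2 hγ.diff
  have hD0 : ∀ z ∈ openAnnulus r R, dslope γ τ z ≠ 0 := by
    intro z hz
    rcases eq_or_ne z τ with rfl | hne
    · rw [dslope_same]; exact hγ.deriv_ne _ hz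
    · rw [dslope_of_ne _ hne, slope_def_field]
      exact div_ne_zero (sub_ne_zero.2 fun h => hne (hγ.inj hz hτ h)) (sub_ne_zero.2 hne)
  set m : ℂ → ℂ := fun z => h z * deriv γ z / dslope γ τ z with hm
  have hmd : DifferentiableOn ℂ m (openAnnulus r R) :=
    (hh.mul hγ.differentiableOn_deriv).div hD hD0
  have hmτ : m τ = h τ := by
    simp only [hm, dslope_same]
    exact mul_div_cancel_right₀ _ (hγ.deriv_ne _ hτ)
  have hed : DifferentiableOn ℂ (dslope m τ) (openAnnulus r R) :=
    (differentiableOn_dslope (hO.mem_nhds hτ)).2 hmd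
  have key : ∀ z ∈ openAnnulus r R, z ≠ τ →
      h z * deriv γ z / (γ z - γ τ) = dslope m τ z + h τ * (z - τ)⁻¹ := by
    intro z hz hne
    have h1 : γ z - γ τ ≠ 0 := sub_ne_zero.2 fun h => hne (hγ.inj hz hτ h)
    have h2 : z - τ ≠ 0 := sub_ne_zero.2 hne
    rw [dslope_of_ne _ hne, slope_def_field, hmτ]
    simp only [hm, dslope_of_ne _ hne, slope_def_field]
    field_simp
    ring
  have h_int : ∀ ρ : ℝ, r < ρ → ρ < R → ρ ≠ ‖τ‖ →
      (∮ z in C(0, ρ), h z * deriv γ z / (γ z - γ τ)) =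
        (∮ z in C(0, ρ), dslope m τ z) + h τ * ∮ z in C(0, ρ), (z - τ)⁻¹ := by
    intro ρ hρ hρR hne
    have hρ0 : 0 ≤ ρ := hr.trans hρ.le
    have hS := sphere_subset_openAnnulus hρ hρR
    have hne' : ∀ z ∈ sphere (0 : ℂ) ρ, z ≠ τ := by
      rintro z hz rfl
      exact hne (mem_sphere_zero_iff_norm.1 hz).symm
    rw [circleIntegral.integral_congr hρ0 (fun z hz => key z (hS hz) (hne' z hz)),
      circleIntegral.integral_add, circleIntegral.integral_const_mul]
    · exact (hed.continuousOn.mono hS).circleIntegrable hρ0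
    · refine ContinuousOn.circleIntegrable hρ0 ?_
      exact continuousOn_const.mul ((continuousOn_id.sub continuousOn_const).inv₀
        fun z hz => sub_ne_zero.2 (hne' z hz))
  rw [h_int t (hs.trans (hsτ.trans hτt)) ht hτt.ne', h_int s hs (hsτ.trans (hτt.trans ht)) hsτ.ne,
    circleIntegral_eq_of_differentiableOn_openAnnulus hr hed hs (hsτ.trans hτt).le ht,
    circleIntegral.integral_sub_inv_of_mem_ball (by simpa using hτt)]
  have : (∮ z in C(0, s), (z - τ)⁻¹) = 0 := by
    refine DiffContOnCl.circleIntegral_eq_zero hs0.le (DifferentiableOn.diffContOnCl ?_)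
    rw [closure_ball _ hs0.ne']
    intro z hz
    have : z ≠ τ := by rintro rfl; simp at hz; linarith
    exact ((differentiableAt_id.sub_const τ).inv (sub_ne_zero.2 this)).differentiableWithinAt
  rw [this]
  ring

/-- The winding integral of a closed curve is locally constant. -/
lemma eventually_circleIntegral_eq {γ : ℂ → ℂ} {r R s : ℝ}
    (hγ : DifferentiableOn ℂ γ (openAnnulus r R)) (hr : 0 ≤ r) (hs : r < s) (hsR : s < R) {b : ℂ}
    (hb : ∀ z ∈ sphere (0 : ℂ) s, γ z ≠ b) :
    ∀ᶠ b' in 𝓝 b, (∮ z in C(0, s), deriv γ z / (γ z - b')) =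
      ∮ z in C(0, s), deriv γ z / (γ z - b) := by
  have hs0 : 0 < s := hr.trans_lt hs
  have hO := isOpen_openAnnulus r R
  have hS := sphere_subset_openAnnulus hs hsR
  have hcont : ContinuousOn γ (sphere 0 s) := hγ.continuousOn.mono hS
  have hdcont : ContinuousOn (deriv γ) (sphere 0 s) := (hγ.deriv hO).continuousOn.mono hS
  have hK : IsCompact (γ '' sphere 0 s) := (isCompact_sphere 0 s).image_of_continuousOn hcont
  have hbK : b ∈ (γ '' sphere 0 s)ᶜ := by rintro ⟨z, hz, h⟩; exact hb z hz h
  obtain ⟨δ, hδ, hball⟩ := Metric.isOpen_iff.1 hK.isClosed.isOpen_compl b hbK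
  filter_upwards [ball_mem_nhds b hδ] with b' hb'
  have hfar : ∀ z ∈ sphere (0 : ℂ) s, δ ≤ ‖γ z - b‖ := by
    intro z hz
    by_contra! h
    exact hball (by simpa [dist_eq_norm] using h) ⟨z, hz, rfl⟩
  have h1 : ∀ z ∈ sphere (0 : ℂ) s, γ z - b ≠ 0 := fun z hz => sub_ne_zero.2 (hb z hz)
  have h2 : ∀ z ∈ sphere (0 : ℂ) s, γ z - b' ≠ 0 := by
    intro z hz h
    exact hball hb' ⟨z, hz, sub_eq_zero.1 h⟩
  rw [← sub_eq_zero, ← circleIntegral.integral_sub]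
  · refine circleIntegral.integral_eq_zero_of_hasDerivWithinAt
      (f := fun z => log ((γ z - b') / (γ z - b))) hs0.le fun z hz => ?_
    have hd : HasDerivAt γ (deriv γ z) z := (hγ.differentiableAt (hO.mem_nhds (hS hz))).hasDerivAt
    have hslit : (γ z - b') / (γ z - b) ∈ slitPlane := by
      have : (γ z - b') / (γ z - b) = 1 + (b - b') / (γ z - b) := by
        field_simp [h1 z hz]; ring
      rw [this]
      refine mem_slitPlane_of_norm_lt_one ?_
      rw [norm_div, div_lt_one (norm_pos_iff.2 (h1 z hz))]
      refine lt_of_lt_of_le ?_ (hfar z hz)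
      rwa [← dist_eq_norm, dist_comm, ← mem_ball]
    have := (((hd.sub_const b').div (hd.sub_const b) (h1 z hz)).clog hslit).hasDerivWithinAt
      (s := sphere 0 s)
    refine this.congr_deriv ?_
    have h1z := h1 z hz
    have h2z := h2 z hz
    simp only [Pi.div_apply]
    field_simp
  · exact (hdcont.div (hcont.sub continuousOn_const) h2).circleIntegrable hs0.le
  · exact (hdcont.div (hcont.sub continuousOn_const) h1).circleIntegrable hs0.le

lemma IsPreconnected.eq_of_eventually_eq {S : Set ℂ} (hS : IsPreconnected S) {f : ℂ → ℂ}
    (hf : ∀ b ∈ S, ∀ᶠ b' in 𝓝 b, f b' = f b) {x y : ℂ} (hx : x ∈ S) (hy : y ∈ S) :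
    f x = f y := by
  have hsub : S ⊆ {b | ∀ᶠ b' in 𝓝 b, f b' = f x} := by
    refine hS.subset_left_of_subset_union (v := {b | ∀ᶠ b' in 𝓝 b, f b' ≠ f x})
      isOpen_setOfPred_eventually_nhds isOpen_setOfPred_eventually_nhds ?_ ?_ ⟨x, hx, hf x hx⟩
    · rw [Set.disjoint_left]
      exact fun b h1 h2 => h2.self_of_nhds h1.self_of_nhds
    · intro b hb
      by_cases h : f b = f x
      · exact Or.inl ((hf b hb).mono fun b' hb' => hb'.trans h)
      · exact Or.inr ((hf b hb).mono fun b' hb' => hb' ▸ h)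
  exact (hsub hy).self_of_nhds.symm

/-- A connected open set cannot touch a closed conformally embedded curve from both sides. -/
lemma IsAnnulusEmbedding.not_both_sides {γ : ℂ → ℂ} {R : ℝ} (hR : 1 < R)
    (hγ : IsAnnulusEmbedding γ R⁻¹ R) {Ω : Set ℂ} (hΩ : IsPreconnected Ω)
    (hdisj : ∀ z ∈ sphere (0 : ℂ) 1, γ z ∉ Ω)
    {σ τ : ℂ} (hσ : σ ∈ openAnnulus R⁻¹ 1) (hτ : τ ∈ openAnnulus 1 R)
    (hσΩ : γ σ ∈ Ω) (hτΩ : γ τ ∈ Ω) : False := by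
  have hR0 : 0 < R := by linarith
  have hRi : R⁻¹ < 1 := inv_lt_one_of_one_lt₀ hR
  have hRi0 : (0 : ℝ) ≤ R⁻¹ := by positivity
  obtain ⟨s, hs1, hs2⟩ := exists_between hσ.1
  obtain ⟨t, ht1, ht2⟩ := exists_between hτ.2
  have hσ2 : ‖σ‖ < 1 := hσ.2
  have hτ1 : 1 < ‖τ‖ := hτ.1
  set W : ℝ → ℂ → ℂ := fun ρ b => ∮ z in C(0, ρ), deriv γ z / (γ z - b) with hW
  have res : ∀ {s t : ℝ} {x : ℂ}, R⁻¹ < s → s < ‖x‖ → ‖x‖ < t → t < R →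
      W t (γ x) - W s (γ x) = 2 * Real.pi * I := by
    intro s t x h1 h2 h3 h4
    simpa using hγ.circleIntegral_sub (h := fun _ => 1) hRi0 (differentiableOn_const _) h1 h2 h3 h4
  have hWΩ : W 1 (γ σ) = W 1 (γ τ) := by
    refine hΩ.eq_of_eventually_eq (f := W 1) (fun b hb => ?_) hσΩ hτΩ
    exact eventually_circleIntegral_eq hγ.diff hRi0 hRi hR fun z hz h => hdisj z hz (h ▸ hb)
  have hsub : openAnnulus s t ⊆ openAnnulus R⁻¹ R := openAnnulus_mono hs1.le ht2.le
  have hWt : W t (γ σ) = W t (γ τ) := by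
    refine ((isPreconnected_openAnnulus (hRi0.trans hs1.le)).image γ
      (hγ.diff.continuousOn.mono hsub)).eq_of_eventually_eq (f := W t) ?_
      ⟨σ, ⟨hs2, by linarith⟩, rfl⟩ ⟨τ, ⟨by linarith, ht1⟩, rfl⟩
    rintro _ ⟨x, hx, rfl⟩
    refine eventually_circleIntegral_eq hγ.diff hRi0 (by linarith) ht2 fun z hz h => ?_
    have hz' := mem_sphere_zero_iff_norm.1 hz
    have := hγ.inj (sphere_subset_openAnnulus (by linarith) ht2 hz) (hsub hx) h
    have := hx.2
    simp_all
  have e1 := res (s := 1) (t := t) (x := τ) hRi hτ1 ht1 ht2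
  have e2 := res (s := s) (t := 1) (x := σ) hs1 hs2 hσ2 hR
  have e3 := res (s := s) (t := t) (x := σ) hs1 hs2 (by linarith) ht2
  have : (2 * Real.pi * I : ℂ) = 0 := by
    linear_combination -e1 + e3 - e2 - hWt + hWΩ
  simp [Real.pi_ne_zero] at this

/-! ### Reflection across the boundary curves -/

/-- Reflection across the unit circle. -/
def circleReflection (σ : ℂ) : ℂ := ((starRingEnd ℂ) σ)⁻¹

lemma norm_circleReflection (σ : ℂ) : ‖circleReflection σ‖ = ‖σ‖⁻¹ := by
  simp [circleReflection]

lemma circleReflection_circleReflection (σ : ℂ) : circleReflection (circleReflection σ) = σ := by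
  simp [circleReflection]

lemma circleReflection_of_norm_eq_one {σ : ℂ} (h : ‖σ‖ = 1) : circleReflection σ = σ := by
  have h0 : (starRingEnd ℂ) σ ≠ 0 := by
    simp only [ne_eq, map_eq_zero]; rintro rfl; simp at h
  rw [circleReflection, inv_eq_iff_eq_inv, eq_comm, inv_eq_iff_eq_inv, ← one_div, eq_div_iff h0,
    mul_conj, normSq_eq_norm_sq, h]
  simp

lemma continuousAt_circleReflection {σ : ℂ} (h : ‖σ‖ = 1) : ContinuousAt circleReflection σ := by
  refine ContinuousAt.inv₀ continuous_conj.continuousAt ?_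
  simp only [ne_eq, map_eq_zero]; rintro rfl; simp at h

lemma tendsto_circleReflection {σ : ℂ} (h : ‖σ‖ = 1) :
    Tendsto circleReflection (𝓝 σ) (𝓝 σ) := by
  simpa [ContinuousAt, circleReflection_of_norm_eq_one h] using continuousAt_circleReflection h

lemma norm_sub_eq_mul_norm_sub_circleReflection {σ τ : ℂ} (hτ : ‖τ‖ = 1) (hσ : σ ≠ 0) :
    ‖τ - σ‖ = ‖σ‖ * ‖τ - circleReflection σ‖ := by
  have h0 : (starRingEnd ℂ) σ ≠ 0 := by simpa using hσ
  have h1 : τ * (starRingEnd ℂ) τ = 1 := by rw [mul_conj, normSq_eq_norm_sq, hτ]; simp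
  have h2 : ‖σ‖ * ‖τ - circleReflection σ‖ = ‖(starRingEnd ℂ) σ * (τ - circleReflection σ)‖ := by
    rw [norm_mul, norm_conj]
  have h3 : (starRingEnd ℂ) σ * (τ - circleReflection σ) = -τ * (starRingEnd ℂ) (τ - σ) := by
    rw [map_sub, circleReflection, mul_sub, mul_inv_cancel₀ h0]
    linear_combination h1
  rw [h2, h3, norm_mul, norm_neg, hτ, one_mul, norm_conj]

/-- Near a curve, distances to curve points from a point and its reflection are comparable. -/
lemma eventually_norm_sub_le_of_ne {f g : ℂ → ℂ} {σ₀ τ₀ : ℂ} (hσ₀ : ‖σ₀‖ = 1)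
    (hf : ContinuousAt f σ₀) (hg : ContinuousAt g τ₀) (hne : g τ₀ ≠ f σ₀) {ε : ℝ} (hε : 0 < ε) :
    ∀ᶠ p : ℂ × ℂ in 𝓝 (σ₀, τ₀),
      ‖g p.2 - f p.1‖ ≤ (1 + ε) * ‖g p.2 - f (circleReflection p.1)‖ := by
  have h2 : Tendsto (fun p : ℂ × ℂ => g p.2) (𝓝 (σ₀, τ₀)) (𝓝 (g τ₀)) :=
    hg.tendsto.comp continuous_snd.continuousAt
  have h1 : Tendsto (fun p : ℂ × ℂ => f p.1) (𝓝 (σ₀, τ₀)) (𝓝 (f σ₀)) :=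
    hf.tendsto.comp continuous_fst.continuousAt
  have h3 : Tendsto (fun p : ℂ × ℂ => f (circleReflection p.1)) (𝓝 (σ₀, τ₀)) (𝓝 (f σ₀)) :=
    hf.tendsto.comp ((tendsto_circleReflection hσ₀).comp continuous_fst.continuousAt)
  have hpos : 0 < ‖g τ₀ - f σ₀‖ := norm_pos_iff.2 (sub_ne_zero.2 hne)
  refine ((h2.sub h1).norm.eventually_lt ((h2.sub h3).norm.const_mul (1 + ε)) ?_).mono
    fun _ h => h.le
  nlinarith

lemma eventually_norm_sub_le_self {f : ℂ → ℂ} {f' σ₀ : ℂ} (hσ₀ : ‖σ₀‖ = 1)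
    (hf : HasStrictDerivAt f f' σ₀) (hf' : f' ≠ 0) {ε : ℝ} (hε : 0 < ε) :
    ∀ᶠ p : ℂ × ℂ in 𝓝 (σ₀, σ₀), ‖p.2‖ = 1 →
      ‖f p.2 - f p.1‖ ≤ (1 + ε) * ‖f p.2 - f (circleReflection p.1)‖ := by
  have hpos : 0 < ‖f'‖ := norm_pos_iff.2 hf'
  obtain ⟨c, hc0, hc, hcε⟩ : ∃ c > 0, c < ‖f'‖ ∧ (‖f'‖ + c) * (1 + c) ≤ (1 + ε) * (‖f'‖ - c) := by
    have : Tendsto (fun c : ℝ => (1 + ε) * (‖f'‖ - c) - (‖f'‖ + c) * (1 + c)) (𝓝[>] 0)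
        (𝓝 ((1 + ε) * (‖f'‖ - 0) - (‖f'‖ + 0) * (1 + 0))) := by
      refine (Continuous.tendsto ?_ 0).mono_left nhdsWithin_le_nhds
      fun_prop
    have hev := this.eventually (lt_mem_nhds (a := 0) (by nlinarith))
    obtain ⟨c, h1, h2, h3⟩ := (hev.and ((eventually_mem_nhdsWithin).and
      (nhdsWithin_le_nhds (eventually_lt_nhds hpos)))).exists
    exact ⟨c, h2, h3, by linarith⟩
  have hlo := hasStrictFDerivAt_iff_isLittleO.1 hf.hasStrictFDerivAt
  have hb := hlo.bound hc0
  have hswap : Tendsto (fun p : ℂ × ℂ => (p.2, p.1)) (𝓝 (σ₀, σ₀)) (𝓝 (σ₀, σ₀)) :=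
    continuous_swap.tendsto _
  have hrefl : Tendsto (fun p : ℂ × ℂ => (p.2, circleReflection p.1)) (𝓝 (σ₀, σ₀))
      (𝓝 (σ₀, σ₀)) := by
    rw [nhds_prod_eq]
    refine tendsto_snd.prodMk ((tendsto_circleReflection hσ₀).comp tendsto_fst)
  have hnorm : ∀ᶠ p : ℂ × ℂ in 𝓝 (σ₀, σ₀), ‖p.1‖ < 1 + c ∧ 0 < ‖p.1‖ := by
    have : Tendsto (fun p : ℂ × ℂ => ‖p.1‖) (𝓝 (σ₀, σ₀)) (𝓝 1) := by
      rw [← hσ₀]; exact (continuous_fst.norm).tendsto (σ₀, σ₀)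
    exact (this.eventually_lt_const (by linarith)).and (this.eventually_const_lt (by norm_num))
  filter_upwards [hswap.eventually hb, hrefl.eventually hb, hnorm] with p h1 h2 h3 h4
  have hs := norm_sub_eq_mul_norm_sub_circleReflection h4 (norm_pos_iff.1 h3.2)
  simp only [ContinuousLinearMap.toSpanSingleton_apply, smul_eq_mul] at h1 h2
  set d := ‖p.2 - circleReflection p.1‖ with hd
  have hd0 : 0 ≤ d := norm_nonneg _
  have e1 : ‖f p.2 - f p.1‖ ≤ (‖f'‖ + c) * ‖p.2 - p.1‖ := by
    have := norm_add_le (f p.2 - f p.1 - (p.2 - p.1) * f') ((p.2 - p.1) * f')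
    rw [sub_add_cancel, norm_mul] at this
    linarith
  have e2 : (‖f'‖ - c) * d ≤ ‖f p.2 - f (circleReflection p.1)‖ := by
    have := norm_sub_le (f p.2 - f (circleReflection p.1))
      (f p.2 - f (circleReflection p.1) - (p.2 - circleReflection p.1) * f')
    rw [sub_sub_cancel, norm_mul] at this
    linarith
  calc ‖f p.2 - f p.1‖ ≤ (‖f'‖ + c) * (‖p.1‖ * d) := by rw [← hs]; exact e1
    _ ≤ (‖f'‖ + c) * ((1 + c) * d) := by gcongr; exact h3.1.le
    _ = ((‖f'‖ + c) * (1 + c)) * d := by ring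
    _ ≤ ((1 + ε) * (‖f'‖ - c)) * d := by gcongr
    _ = (1 + ε) * ((‖f'‖ - c) * d) := by ring
    _ ≤ _ := by gcongr

namespace MCDomain

variable (D : MCDomain n)

lemma subset_frontier (j : Fin (n + 1)) : D.Γ j ⊆ frontier D.Ω := by
  rw [D.frontier_eq]; exact subset_iUnion _ j

lemma isCompact_curve (j : Fin (n + 1)) : IsCompact (D.Γ j) := by
  obtain ⟨γ, ha, -, him, -⟩ := D.curve j
  rw [← him]
  exact (isCompact_sphere 0 1).image_of_continuousOn ha.continuousOn

lemma isCompact_frontier : IsCompact (frontier D.Ω) := by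
  rw [D.frontier_eq]; exact isCompact_iUnion D.isCompact_curve

lemma notMem_frontier {z : ℂ} (hz : z ∈ D.Ω) : z ∉ frontier D.Ω :=
  fun h => (D.isOpen.frontier_eq ▸ h).2 hz

lemma mem_or_mem_frontier {z : ℂ} (hz : z ∈ closure D.Ω) : z ∈ D.Ω ∨ z ∈ frontier D.Ω := by
  rw [closure_eq_self_union_frontier] at hz; exact hz

/-- Every boundary component extends to a conformal embedding of an annulus which meets the
boundary of the domain only along the unit circle. -/
lemma exists_annulusEmbedding (j : Fin (n + 1)) :
    ∃ (γ : ℂ → ℂ) (R : ℝ), 1 < R ∧ IsAnnulusEmbedding γ R⁻¹ R ∧ γ '' sphere 0 1 = D.Γ j ∧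
      ∀ σ ∈ openAnnulus R⁻¹ R, ‖σ‖ ≠ 1 → γ σ ∉ frontier D.Ω := by
  obtain ⟨γ, ha, hinj, him, hder⟩ := D.curve j
  have hK := isCompact_sphere (0 : ℂ) 1
  have hstrict : ∀ z ∈ sphere (0 : ℂ) 1, HasStrictDerivAt γ (deriv γ z) z :=
    fun z hz => (ha z hz).hasStrictDerivAt
  obtain ⟨t, ht, htinj⟩ := hinj.exists_mem_nhdsSet hK (fun z hz => (ha z hz).continuousAt)
    (fun z hz => by
      have := (hstrict z hz).hasStrictFDerivAt_equiv (hder z hz)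
      exact ⟨this.toOpenPartialHomeomorph.source,
        this.toOpenPartialHomeomorph.open_source.mem_nhds this.mem_toOpenPartialHomeomorph_source,
        this.toOpenPartialHomeomorph.injOn⟩)
  have hother : IsClosed (⋃ k ∈ {k | k ≠ j}, D.Γ k) :=
    (Set.toFinite _).isClosed_biUnion fun k _ => (D.isCompact_curve k).isClosed
  have hgood : ∀ᶠ z in 𝓝ˢ (sphere (0 : ℂ) 1), z ∈ t ∧ DifferentiableAt ℂ γ z ∧ deriv γ z ≠ 0 ∧
      γ z ∈ (⋃ k ∈ {k | k ≠ j}, D.Γ k)ᶜ := by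
    refine Eventually.and ht (Eventually.and ?_ (Eventually.and ?_ ?_)) <;>
      refine eventually_nhdsSet_iff_forall.2 fun z hz => ?_
    · exact (ha z hz).eventually_analyticAt.mono fun _ h => h.differentiableAt
    · exact (ha z hz).deriv.continuousAt.eventually_ne (hder z hz)
    · refine (ha z hz).continuousAt (hother.isOpen_compl.mem_nhds ?_)
      simp only [mem_compl_iff, mem_iUnion, not_exists]
      intro k hk h
      exact Set.disjoint_left.1 (D.disj k j hk) h (him ▸ mem_image_of_mem γ hz)
  obtain ⟨R, hR, hsub⟩ := exists_openAnnulus_subset hgood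
  have hR0 : 0 < R := by linarith
  refine ⟨γ, R, hR, ⟨fun z hz => (hsub hz).2.1.differentiableWithinAt,
    htinj.mono fun z hz => (hsub hz).1, fun z hz => (hsub hz).2.2.1⟩, him, ?_⟩
  intro σ hσ hne h
  rw [D.frontier_eq, mem_iUnion] at h
  obtain ⟨k, hk⟩ := h
  by_cases hkj : k = j
  · subst hkj
    rw [← him] at hk
    obtain ⟨τ, hτ, hτσ⟩ := hk
    have := htinj (subset_of_mem_nhdsSet ht hτ) (hsub hσ).1 hτσ
    exact hne (this ▸ mem_sphere_zero_iff_norm.1 hτ)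
  · exact (hsub hσ).2.2.2 (mem_biUnion (show k ∈ {k | k ≠ j} from hkj) hk)

lemma reflection_notMem_closure {γ : ℂ → ℂ} {R : ℝ} (hR : 1 < R) (hγ : IsAnnulusEmbedding γ R⁻¹ R)
    (hcirc : γ '' sphere 0 1 ⊆ frontier D.Ω)
    (hoff : ∀ σ ∈ openAnnulus R⁻¹ R, ‖σ‖ ≠ 1 → γ σ ∉ frontier D.Ω) {σ : ℂ}
    (hσ : σ ∈ openAnnulus R⁻¹ R) (hσΩ : γ σ ∈ D.Ω) :
    γ (circleReflection σ) ∉ closure D.Ω := by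
  intro hcl
  have hR0 : 0 < R := by linarith
  have hσ0 : 0 < ‖σ‖ := lt_trans (by positivity) hσ.1
  have hne : ‖σ‖ ≠ 1 := fun h =>
    D.notMem_frontier hσΩ (hcirc ⟨σ, mem_sphere_zero_iff_norm.2 h, rfl⟩)
  have hσ' : circleReflection σ ∈ openAnnulus R⁻¹ R := by
    constructor
    · rw [norm_circleReflection]; exact inv_strictAnti₀ hσ0 hσ.2
    · rw [norm_circleReflection]; exact inv_lt_of_inv_lt₀ hR0 hσ.1
  have hne' : ‖circleReflection σ‖ ≠ 1 := by
    rw [norm_circleReflection]; simpa using hne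
  have hΩ' := (D.mem_or_mem_frontier hcl).resolve_right (hoff _ hσ' hne')
  have hdisj : ∀ z ∈ sphere (0 : ℂ) 1, γ z ∉ D.Ω :=
    fun z hz h => D.notMem_frontier h (hcirc ⟨z, hz, rfl⟩)
  rcases lt_or_gt_of_ne hne with h | h
  · refine hγ.not_both_sides hR D.conn.isPreconnected hdisj (σ := σ) (τ := circleReflection σ)
      ⟨hσ.1, h⟩ ⟨?_, hσ'.2⟩ hσΩ hΩ'
    rw [norm_circleReflection]; exact one_lt_inv₀ hσ0 |>.2 h
  · refine hγ.not_both_sides hR D.conn.isPreconnected hdisj (σ := circleReflection σ) (τ := σ)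
      ⟨hσ'.1, ?_⟩ ⟨h, hσ.2⟩ hΩ' hσΩ
    rw [norm_circleReflection]; exact inv_lt_one_of_one_lt₀ h

/-- The distance from a point of the domain to the complement. -/
def bdist (z : ℂ) : ℝ := infDist z D.Ωᶜ

lemma exists_mem_compl : (D.Ωᶜ).Nonempty := by
  by_contra h
  rw [Set.not_nonempty_iff_eq_empty, compl_empty_iff] at h
  have := D.bdd
  rw [h] at this
  exact NormedSpace.unbounded_univ ℝ ℂ this

lemma bdist_pos {z : ℂ} (hz : z ∈ D.Ω) : 0 < D.bdist z :=
  (D.isOpen.isClosed_compl.notMem_iff_infDist_pos D.exists_mem_compl).1 (by simpa using hz)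

/-- The distance to the complement is attained on the boundary. -/
lemma exists_frontier_dist_eq {z : ℂ} (hz : z ∈ D.Ω) :
    ∃ ζ ∈ frontier D.Ω, ‖z - ζ‖ = D.bdist z := by
  obtain ⟨ζ, hζ, h⟩ := D.isOpen.isClosed_compl.exists_infDist_eq_dist D.exists_mem_compl z
  refine ⟨ζ, ?_, by rw [bdist, h, dist_eq_norm]⟩
  rw [D.isOpen.frontier_eq]
  refine ⟨closure_mono (ball_infDist_compl_subset (x := z)) ?_, hζ⟩
  rw [closure_ball z (show infDist z D.Ωᶜ ≠ 0 from (D.bdist_pos hz).ne'), mem_closedBall, dist_comm, h]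

lemma bdist_le {z ζ : ℂ} (hζ : ζ ∈ frontier D.Ω) : D.bdist z ≤ ‖z - ζ‖ := by
  rw [← dist_eq_norm]
  exact infDist_le_dist_of_mem (fun h => D.notMem_frontier h hζ)

/-- Points near the boundary have exterior reflections, at almost the same distance from every
boundary point. -/
lemma exists_reflection {ε : ℝ} (hε : 0 < ε) :
    ∃ r > 0, ∀ b ∈ D.Ω, D.bdist b < r → ∃ b', b' ∉ closure D.Ω ∧ ∀ ζ ∈ frontier D.Ω,
      ‖ζ - b‖ ≤ (1 + ε) * ‖ζ - b'‖ ∧ ‖ζ - b'‖ ≤ (1 + ε) * ‖ζ - b‖ := by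
  choose γ R hR hγ him hoff using D.exists_annulusEmbedding
  have hK := isCompact_sphere (0 : ℂ) 1
  have hSA : ∀ j, sphere (0 : ℂ) 1 ⊆ openAnnulus (R j)⁻¹ (R j) := fun j =>
    sphere_subset_openAnnulus (inv_lt_one_of_one_lt₀ (hR j)) (hR j)
  have han : ∀ j, ∀ z ∈ sphere (0 : ℂ) 1, AnalyticAt ℂ (γ j) z := fun j z hz =>
    (hγ j).diff.analyticAt ((isOpen_openAnnulus _ _).mem_nhds (hSA j hz))
  have hratio : ∀ j k, ∀ σ₀ ∈ sphere (0 : ℂ) 1, ∀ᶠ σ in 𝓝 σ₀, ∀ τ ∈ sphere (0 : ℂ) 1,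
      ‖γ k τ - γ j σ‖ ≤ (1 + ε) * ‖γ k τ - γ j (circleReflection σ)‖ := by
    intro j k σ₀ hσ₀
    have hσ₀' := mem_sphere_zero_iff_norm.1 hσ₀
    refine (hK.eventually_forall_of_forall_eventually (P := fun σ τ => ‖τ‖ = 1 →
      ‖γ k τ - γ j σ‖ ≤ (1 + ε) * ‖γ k τ - γ j (circleReflection σ)‖) fun τ₀ hτ₀ => ?_).mono
      fun σ h τ hτ => h τ hτ (mem_sphere_zero_iff_norm.1 hτ)
    by_cases heq : γ k τ₀ = γ j σ₀
    · have hkj : k = j := by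
        by_contra hkj
        refine Set.disjoint_left.1 (D.disj k j hkj) (show γ k τ₀ ∈ D.Γ k from ?_) ?_
        · rw [← him k]; exact ⟨τ₀, hτ₀, rfl⟩
        · rw [heq, ← him j]; exact ⟨σ₀, hσ₀, rfl⟩
      subst hkj
      obtain rfl := (hγ k).inj (hSA k hτ₀) (hSA k hσ₀) heq
      exact eventually_norm_sub_le_self hσ₀' (han k τ₀ hσ₀).hasStrictDerivAt
        ((hγ k).deriv_ne _ (hSA k hσ₀)) hε
    · exact (eventually_norm_sub_le_of_ne hσ₀' (han j _ hσ₀).continuousAt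
        (han k _ hτ₀).continuousAt heq hε).mono fun _ h _ => h
  have hnhds : ∀ j, ∀ ζ ∈ D.Γ j, {b | ∃ σ ∈ openAnnulus (R j)⁻¹ (R j), γ j σ = b ∧
      ∀ k, ∀ τ ∈ sphere (0 : ℂ) 1,
        ‖γ k τ - γ j σ‖ ≤ (1 + ε) * ‖γ k τ - γ j (circleReflection σ)‖ ∧
        ‖γ k τ - γ j (circleReflection σ)‖ ≤ (1 + ε) * ‖γ k τ - γ j σ‖} ∈ 𝓝 ζ := by
    intro j ζ hζ
    rw [← him j] at hζ
    obtain ⟨σ₀, hσ₀, rfl⟩ := hζ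
    rw [← (han j σ₀ hσ₀).hasStrictDerivAt.map_nhds_eq ((hγ j).deriv_ne _ (hSA j hσ₀))]
    rw [mem_map]
    have h1 := eventually_all.2 fun k => hratio j k σ₀ hσ₀
    have h2 := (tendsto_circleReflection (mem_sphere_zero_iff_norm.1 hσ₀)).eventually h1
    filter_upwards [h1, h2, (isOpen_openAnnulus _ _).mem_nhds (hSA j hσ₀)] with σ h1 h2 h3
    refine ⟨σ, h3, rfl, fun k τ hτ => ⟨h1 k τ hτ, ?_⟩⟩
    simpa [circleReflection_circleReflection] using h2 k τ hτ
  have hU : {b | ∃ j, ∃ σ ∈ openAnnulus (R j)⁻¹ (R j), γ j σ = b ∧ ∀ k, ∀ τ ∈ sphere (0 : ℂ) 1,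
        ‖γ k τ - γ j σ‖ ≤ (1 + ε) * ‖γ k τ - γ j (circleReflection σ)‖ ∧
        ‖γ k τ - γ j (circleReflection σ)‖ ≤ (1 + ε) * ‖γ k τ - γ j σ‖} ∈
      𝓝ˢ (frontier D.Ω) := by
    refine mem_nhdsSet_iff_forall.2 fun ζ hζ => ?_
    rw [D.frontier_eq, mem_iUnion] at hζ
    obtain ⟨j, hj⟩ := hζ
    filter_upwards [hnhds j ζ hj] with b hb using ⟨j, hb⟩
  obtain ⟨V, hVo, hV, hVU⟩ := mem_nhdsSet_iff_exists.1 hU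
  obtain ⟨r, hr, hrV⟩ := D.isCompact_frontier.exists_thickening_subset_open hVo hV
  refine ⟨r, hr, fun b hb hbr => ?_⟩
  obtain ⟨ζ, hζ, hζb⟩ := D.exists_frontier_dist_eq hb
  have hbV : b ∈ V := hrV (mem_thickening_iff.2 ⟨ζ, hζ, by rw [dist_eq_norm, hζb]; exact hbr⟩)
  obtain ⟨j, σ, hσ, rfl, h⟩ := hVU hbV
  refine ⟨γ j (circleReflection σ), D.reflection_notMem_closure (hR j) (hγ j)
    ((him j).subset.trans (D.subset_frontier j)) (hoff j) hσ hb, fun ζ hζ => ?_⟩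
  rw [D.frontier_eq, mem_iUnion] at hζ
  obtain ⟨k, hk⟩ := hζ
  rw [← him k] at hk
  obtain ⟨τ, hτ, rfl⟩ := hk
  exact h k τ hτ

end MCDomain

/-! ### Harmonic functions -/

namespace IsHarmonicOn

variable {u v : ℂ → ℝ} {U : Set ℂ}

lemma continuousOn (hu : IsHarmonicOn u U) : ContinuousOn u U := by
  intro z hz
  obtain ⟨r, hr, -, g, hg, hug⟩ := hu z hz
  have hc : ContinuousAt (fun w => (g w).re) z :=
    continuous_re.continuousAt.comp
      (hg.continuousOn.continuousAt (isOpen_ball.mem_nhds (mem_ball_self hr)))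
  refine (hc.congr ?_).continuousWithinAt
  filter_upwards [isOpen_ball.mem_nhds (mem_ball_self hr)] with w hw using (hug w hw).symm

lemma add (hu : IsHarmonicOn u U) (hv : IsHarmonicOn v U) :
    IsHarmonicOn (fun z => u z + v z) U := by
  intro z hz
  obtain ⟨r, hr, hrU, g, hg, hug⟩ := hu z hz
  obtain ⟨s, hs, hsU, h, hh, hvh⟩ := hv z hz
  have h1 : ball z (min r s) ⊆ ball z r := ball_subset_ball (min_le_left _ _)
  have h2 : ball z (min r s) ⊆ ball z s := ball_subset_ball (min_le_right _ _)
  refine ⟨min r s, lt_min hr hs, h1.trans hrU, fun w => g w + h w, (hg.mono h1).add (hh.mono h2),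
    fun w hw => ?_⟩
  simp only [hug w (h1 hw), hvh w (h2 hw), add_re]

lemma const_mul (hu : IsHarmonicOn u U) (c : ℝ) : IsHarmonicOn (fun z => c * u z) U := by
  intro z hz
  obtain ⟨r, hr, hrU, g, hg, hug⟩ := hu z hz
  refine ⟨r, hr, hrU, fun w => c * g w, hg.const_mul _, fun w hw => ?_⟩
  simp only [hug w hw, re_ofReal_mul]

lemma congr (hu : IsHarmonicOn u U) (h : ∀ z ∈ U, v z = u z) : IsHarmonicOn v U := by
  intro z hz
  obtain ⟨r, hr, hrU, g, hg, hug⟩ := hu z hz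
  exact ⟨r, hr, hrU, g, hg, fun w hw => (h w (hrU hw)).trans (hug w hw)⟩

end IsHarmonicOn

lemma isHarmonicOn_const {U : Set ℂ} (hU : IsOpen U) (c : ℝ) : IsHarmonicOn (fun _ => c) U := by
  intro z hz
  obtain ⟨r, hr, hrU⟩ := Metric.isOpen_iff.1 hU z hz
  exact ⟨r, hr, hrU, fun _ => c, differentiableOn_const _, fun w _ => by simp⟩

lemma one_sub_div_mem_slitPlane {a b ζ : ℂ} (h : ‖b - a‖ < ‖ζ - a‖) :
    1 - (b - a) / (ζ - a) ∈ slitPlane := by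
  have h0 : 0 < ‖ζ - a‖ := (norm_nonneg _).trans_lt h
  rw [sub_eq_add_neg]
  refine mem_slitPlane_of_norm_lt_one ?_
  rwa [norm_neg, norm_div, div_lt_one h0]

lemma log_norm_sub_eq_re {a b ζ : ℂ} (h : ‖b - a‖ < ‖ζ - a‖) :
    Real.log ‖ζ - b‖ = ((Real.log ‖ζ - a‖ : ℂ) + log (1 - (b - a) / (ζ - a))).re := by
  have h0 : 0 < ‖ζ - a‖ := (norm_nonneg _).trans_lt h
  have h1 : ζ - a ≠ 0 := norm_pos_iff.1 h0
  have h2 := slitPlane_ne_zero (one_sub_div_mem_slitPlane h)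
  rw [add_re, ofReal_re, log_re, ← Real.log_mul h0.ne' (norm_ne_zero_iff.2 h2), ← norm_mul]
  congr 2
  field_simp
  ring

lemma hasDerivAt_log_one_sub_div {a b ζ : ℂ} (h : ‖b - a‖ < ‖ζ - a‖) :
    HasDerivAt (fun b => (Real.log ‖ζ - a‖ : ℂ) + log (1 - (b - a) / (ζ - a))) (b - ζ)⁻¹ b := by
  have h1 : ζ - a ≠ 0 := norm_pos_iff.1 ((norm_nonneg _).trans_lt h)
  have h2 := slitPlane_ne_zero (one_sub_div_mem_slitPlane h)
  have := (((((hasDerivAt_id b).sub_const a).div_const (ζ - a)).const_sub 1).clog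
    (one_sub_div_mem_slitPlane h)).const_add (Real.log ‖ζ - a‖ : ℂ)
  refine this.congr_deriv ?_
  have h3 : b - ζ ≠ 0 := by
    intro h4
    apply h2
    rw [sub_eq_zero.1 h4, div_self h1, sub_self]
  have h4 : 1 - (b - a) / (ζ - a) = -(b - ζ) / (ζ - a) := by field_simp; ring
  simp only [id]
  rw [h4]
  field_simp

lemma isHarmonicOn_log_norm_sub {U : Set ℂ} (hU : IsOpen U) {ζ : ℂ} (hζ : ζ ∉ U) :
    IsHarmonicOn (fun z => Real.log ‖z - ζ‖) U := by
  intro z hz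
  obtain ⟨r, hr, hrU⟩ := Metric.isOpen_iff.1 hU z hz
  have hlt : ∀ w ∈ ball z r, ‖w - z‖ < ‖ζ - z‖ := by
    intro w hw
    rw [mem_ball, dist_eq_norm] at hw
    refine hw.trans_le (not_lt.1 fun h => hζ (hrU ?_))
    rwa [mem_ball, dist_eq_norm]
  refine ⟨r, hr, hrU, _, fun w hw =>
    (hasDerivAt_log_one_sub_div (hlt w hw)).differentiableAt.differentiableWithinAt, fun w hw => ?_⟩
  simp only [norm_sub_rev w ζ]
  exact log_norm_sub_eq_re (hlt w hw)

namespace MCDomain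

variable (D : MCDomain n)

/-! ### Potentials of harmonic measure -/

lemma ae_mem_frontier {w : ℂ} (hw : w ∈ D.Ω) : ∀ᵐ ζ ∂D.ωm w, ζ ∈ frontier D.Ω := D.supp w hw

lemma restrict_frontier {w : ℂ} (hw : w ∈ D.Ω) :
    (D.ωm w).restrict (frontier D.Ω) = D.ωm w :=
  Measure.restrict_eq_self_of_ae_mem (D.ae_mem_frontier hw)

lemma integrable_of_continuousOn {E : Type*} [NormedAddCommGroup E] {w : ℂ} (hw : w ∈ D.Ω)
    {f : ℂ → E} (hf : ContinuousOn f (frontier D.Ω)) : Integrable f (D.ωm w) := by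
  have := D.prob w hw
  rw [← D.restrict_frontier hw]
  exact hf.integrableOn_compact D.isCompact_frontier

lemma integral_congr_frontier {E : Type*} [NormedAddCommGroup E] [NormedSpace ℝ E]
    {w : ℂ} (hw : w ∈ D.Ω)
    {f g : ℂ → E} (hfg : ∀ ζ ∈ frontier D.Ω, f ζ = g ζ) : ∫ ζ, f ζ ∂D.ωm w = ∫ ζ, g ζ ∂D.ωm w :=
  integral_congr_ae ((D.ae_mem_frontier hw).mono hfg)

/-- The logarithmic potential of the harmonic measure at `w`. -/
def potential (w b : ℂ) : ℝ := ∫ ζ, Real.log ‖ζ - b‖ ∂D.ωm w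

lemma continuousOn_log_norm_sub {b : ℂ} {S : Set ℂ} (hb : b ∉ S) :
    ContinuousOn (fun ζ => Real.log ‖ζ - b‖) S := by
  refine ContinuousOn.log (by fun_prop) fun ζ hζ => norm_ne_zero_iff.2 (sub_ne_zero.2 ?_)
  rintro rfl
  exact hb hζ

lemma isHarmonicOn_potential {w : ℂ} (hw : w ∈ D.Ω) : IsHarmonicOn (D.potential w) D.Ω := by
  have := D.prob w hw
  intro b₀ hb₀
  set ρ := D.bdist b₀ / 2 with hρ
  have hρ0 : 0 < ρ := half_pos (D.bdist_pos hb₀)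
  have hfar : ∀ ζ ∈ frontier D.Ω, 2 * ρ ≤ ‖ζ - b₀‖ := by
    intro ζ hζ
    rw [norm_sub_rev]
    linarith [D.bdist_le (z := b₀) hζ]
  have hsub : ball b₀ ρ ⊆ D.Ω := by
    refine (ball_subset_ball ?_).trans (ball_infDist_compl_subset (x := b₀))
    change ρ ≤ D.bdist b₀
    linarith
  have hlt : ∀ b ∈ ball b₀ ρ, ∀ ζ ∈ frontier D.Ω, ‖b - b₀‖ < ‖ζ - b₀‖ := by
    intro b hb ζ hζ
    rw [mem_ball, dist_eq_norm] at hb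
    linarith [hfar ζ hζ]
  set F : ℂ → ℂ → ℂ := fun b ζ => (Real.log ‖ζ - b₀‖ : ℂ) + log (1 - (b - b₀) / (ζ - b₀)) with hF
  have hFc : ∀ b ∈ ball b₀ ρ, ContinuousOn (F b) (frontier D.Ω) := by
    intro b hb
    refine ContinuousOn.add ?_ ?_
    · exact continuous_ofReal.comp_continuousOn
        (continuousOn_log_norm_sub (D.notMem_frontier hb₀))
    · refine ContinuousOn.clog ?_ fun ζ hζ => one_sub_div_mem_slitPlane (hlt b hb ζ hζ)
      refine continuousOn_const.sub (continuousOn_const.div (by fun_prop) fun ζ hζ => ?_)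
      exact norm_pos_iff.1 ((by positivity : (0 : ℝ) < 2 * ρ).trans_le (hfar ζ hζ))
  refine ⟨ρ, hρ0, hsub, fun b => ∫ ζ, F b ζ ∂D.ωm w, ?_, ?_⟩
  · intro b hb
    refine DifferentiableAt.differentiableWithinAt ?_
    refine (hasDerivAt_integral_of_dominated_loc_of_deriv_le (𝕜 := ℂ) (F := F)
      (F' := fun b ζ => (b - ζ)⁻¹) (bound := fun _ => ρ⁻¹) (isOpen_ball.mem_nhds hb)
      ?_ ?_ ?_ ?_ ?_ ?_).2.differentiableAt
    · filter_upwards [isOpen_ball.mem_nhds hb] with b' hb'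
      exact (D.integrable_of_continuousOn hw (hFc b' hb')).aestronglyMeasurable
    · exact D.integrable_of_continuousOn hw (hFc b hb)
    · exact (by fun_prop : Measurable fun ζ : ℂ => (b - ζ)⁻¹).aestronglyMeasurable
    · filter_upwards [D.ae_mem_frontier hw] with ζ hζ b' hb'
      rw [norm_inv]
      refine inv_anti₀ hρ0 ?_
      rw [mem_ball, dist_eq_norm] at hb'
      have := norm_sub_le_norm_sub_add_norm_sub ζ b' b₀
      rw [norm_sub_rev ζ b'] at this
      linarith [hfar ζ hζ]
    · exact integrable_const _
    · filter_upwards [D.ae_mem_frontier hw] with ζ hζ b' hb'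
      exact hasDerivAt_log_one_sub_div (hlt b' hb' ζ hζ)
  · intro b hb
    have h1 := D.integrable_of_continuousOn hw (hFc b hb)
    have h2 := reCLM.integral_comp_comm h1
    simp only [reCLM_apply] at h2
    rw [← h2]
    exact D.integral_congr_frontier hw fun ζ hζ => log_norm_sub_eq_re (hlt b hb ζ hζ)

lemma potential_of_notMem_closure {w b : ℂ} (hw : w ∈ D.Ω) (hb : b ∉ closure D.Ω) :
    D.potential w b = Real.log ‖w - b‖ :=
  (D.dirichlet (fun z => Real.log ‖z - b‖) (continuousOn_log_norm_sub hb)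
    (isHarmonicOn_log_norm_sub D.isOpen fun h => hb (subset_closure h)) w hw).symm

lemma abs_log_sub_log_le {x y ε : ℝ} (hx : 0 < x) (hy : 0 < y) (hε : 0 < ε)
    (h1 : x ≤ (1 + ε) * y) (h2 : y ≤ (1 + ε) * x) : |Real.log x - Real.log y| ≤ ε := by
  have hl : Real.log (1 + ε) ≤ ε := by
    have := Real.log_le_sub_one_of_pos (show 0 < 1 + ε by positivity); linarith
  have e1 := Real.log_le_log hx h1
  have e2 := Real.log_le_log hy h2
  rw [Real.log_mul (by positivity) (by positivity)] at e1 e2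
  rw [abs_le]; constructor <;> linarith

/-- The potential extends continuously to the boundary by `log ‖w - b‖`. -/
lemma tendsto_potential {w b₀ : ℂ} (hw : w ∈ D.Ω) (hb₀ : b₀ ∈ frontier D.Ω) :
    Tendsto (D.potential w) (𝓝[D.Ω] b₀) (𝓝 (Real.log ‖w - b₀‖)) := by
  have := D.prob w hw
  have hwb : w ≠ b₀ := fun h => D.notMem_frontier hw (h ▸ hb₀)
  have hlog : ContinuousAt (fun b => Real.log ‖w - b‖) b₀ :=
    ContinuousAt.log (by fun_prop) (norm_ne_zero_iff.2 (sub_ne_zero.2 hwb))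
  rw [Metric.tendsto_nhds]
  intro ε hε
  obtain ⟨δ, hδ, hδlog⟩ := Metric.continuousAt_iff.1 hlog (ε / 2) (half_pos hε)
  obtain ⟨r, hr, href⟩ := D.exists_reflection (ε := min (ε / 4) 1) (by positivity)
  have hev : ∀ᶠ b in 𝓝 b₀, ‖b - b₀‖ < min r (δ / 3) := by
    have : Tendsto (fun b => ‖b - b₀‖) (𝓝 b₀) (𝓝 0) := by
      have := (continuous_id.sub (continuous_const (y := b₀))).norm.tendsto b₀
      simpa using this
    exact this.eventually_lt_const (by positivity)
  filter_upwards [nhdsWithin_le_nhds hev, self_mem_nhdsWithin] with b hb hbΩ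
  obtain ⟨b', hb', hζ⟩ := href b hbΩ ((D.bdist_le hb₀).trans_lt (hb.trans_le (min_le_left _ _)))
  have hclose : dist b' b₀ < δ := by
    have h1 := (hζ b₀ hb₀).2
    have h2 : min (ε / 4) 1 ≤ 1 := min_le_right _ _
    have h3 := hb.trans_le (min_le_right _ _)
    rw [dist_comm, dist_eq_norm]
    rw [norm_sub_rev b₀ b] at h1
    nlinarith [norm_nonneg (b - b₀)]
  have hdiff : |D.potential w b - D.potential w b'| ≤ ε / 4 := by
    have hb'f : b' ∉ frontier D.Ω := fun h => hb' (frontier_subset_closure h)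
    have hbf := D.notMem_frontier hbΩ
    have i1 := D.integrable_of_continuousOn hw (continuousOn_log_norm_sub hbf)
    have i2 := D.integrable_of_continuousOn hw (continuousOn_log_norm_sub hb'f)
    rw [potential, potential, ← integral_sub i1 i2, ← Real.norm_eq_abs]
    refine (norm_integral_le_of_norm_le_const (C := ε / 4) ?_).trans (by simp)
    filter_upwards [D.ae_mem_frontier hw] with ζ hζf
    refine (abs_log_sub_log_le ?_ ?_ (by positivity) (hζ ζ hζf).1 (hζ ζ hζf).2).trans
      (min_le_left _ _)
    · exact norm_pos_iff.2 (sub_ne_zero.2 fun h => hbf (h ▸ hζf))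
    · exact norm_pos_iff.2 (sub_ne_zero.2 fun h => hb'f (h ▸ hζf))
  have h4 := hδlog hclose
  rw [Real.dist_eq] at h4 ⊢
  rw [D.potential_of_notMem_closure hw hb'] at hdiff
  rw [abs_le] at hdiff
  rw [abs_lt] at h4 ⊢
  constructor <;> linarith

/-! ### The Dirichlet problem -/

/-- Continuous boundary data for which the Dirichlet problem is solvable. -/
def solvable : Submodule ℝ C(frontier D.Ω, ℝ) where
  carrier := {g | ∃ u : ℂ → ℝ, ContinuousOn u (closure D.Ω) ∧ IsHarmonicOn u D.Ω ∧
    ∀ ζ : frontier D.Ω, u ζ = g ζ}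
  add_mem' := by
    rintro g h ⟨u, hu, hu', hug⟩ ⟨v, hv, hv', hvh⟩
    exact ⟨fun z => u z + v z, hu.add hv, hu'.add hv', fun ζ => by simp [hug, hvh]⟩
  zero_mem' := ⟨fun _ => 0, continuousOn_const, isHarmonicOn_const D.isOpen 0, fun ζ => rfl⟩
  smul_mem' := by
    rintro c g ⟨u, hu, hu', hug⟩
    exact ⟨fun z => c * u z, continuousOn_const.mul hu, hu'.const_mul c, fun ζ => by simp [hug]⟩

/-- The logarithmic kernel as a continuous function on the boundary. -/
def logKernel (b : ℂ) (hb : b ∉ frontier D.Ω) : C(frontier D.Ω, ℝ) :=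
  ⟨fun ζ => Real.log ‖(ζ : ℂ) - b‖,
    continuousOn_iff_continuous_domRestrict.1 (continuousOn_log_norm_sub hb)⟩

lemma logKernel_mem_solvable {b : ℂ} (hb : b ∉ frontier D.Ω) :
    D.logKernel b hb ∈ D.solvable := by
  by_cases hbc : b ∈ closure D.Ω
  swap
  · exact ⟨fun z => Real.log ‖z - b‖, continuousOn_log_norm_sub hbc,
      isHarmonicOn_log_norm_sub D.isOpen fun h => hbc (subset_closure h), fun ζ => rfl⟩
  have hbΩ := (D.mem_or_mem_frontier hbc).resolve_right hb
  classical
  set u : ℂ → ℝ := fun z => if z ∈ D.Ω then D.potential b z else Real.log ‖z - b‖ with hu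
  have huΩ : ∀ z ∈ D.Ω, u z = D.potential b z := fun z hz => if_pos hz
  have huF : ∀ z ∈ frontier D.Ω, u z = Real.log ‖z - b‖ :=
    fun z hz => if_neg fun h => D.notMem_frontier h hz
  have hharm : IsHarmonicOn u D.Ω := (D.isHarmonicOn_potential hbΩ).congr huΩ
  refine ⟨u, ?_, hharm, fun ζ => huF ζ ζ.2⟩
  intro z hz
  rcases D.mem_or_mem_frontier hz with hzΩ | hzF
  · exact (hharm.continuousOn.continuousAt (D.isOpen.mem_nhds hzΩ)).continuousWithinAt
  · rw [closure_eq_self_union_frontier]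
    refine ContinuousWithinAt.union ?_ ?_
    · rw [ContinuousWithinAt, huF z hzF, norm_sub_rev]
      exact (D.tendsto_potential hbΩ hzF).congr' (by
        filter_upwards [self_mem_nhdsWithin] with x hx using (huΩ x hx).symm)
    · exact (continuousOn_log_norm_sub hb z hzF).congr huF (huF z hzF)

end MCDomain

namespace MCDomain

variable (D : MCDomain n)

instance : CompactSpace (frontier D.Ω) := isCompact_iff_compactSpace.1 D.isCompact_frontier

/-! ### Density of solvable boundary data -/

/-- Real part of complex boundary data. -/
def reData : C(frontier D.Ω, ℂ) →L[ℝ] C(frontier D.Ω, ℝ) :=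
  ContinuousLinearMap.compLeftContinuous ℝ (frontier D.Ω) reCLM

lemma reData_apply (f : C(frontier D.Ω, ℂ)) (ζ : frontier D.Ω) : D.reData f ζ = (f ζ).re := rfl

/-- Complex boundary data all of whose complex multiples have real part approximable by solvable
data. -/
def approxData : Submodule ℂ C(frontier D.Ω, ℂ) where
  carrier := {f | ∀ c : ℂ, D.reData (c • f) ∈ D.solvable.topologicalClosure}
  add_mem' := by
    intro f g hf hg c
    rw [smul_add, map_add]
    exact add_mem (hf c) (hg c)
  zero_mem' := by
    intro c
    rw [smul_zero, map_zero]
    exact zero_mem _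
  smul_mem' := by
    intro a f hf c
    rw [smul_smul]
    exact hf _

lemma mem_approxData {f : C(frontier D.Ω, ℂ)} :
    f ∈ D.approxData ↔ ∀ c : ℂ, D.reData (c • f) ∈ D.solvable.topologicalClosure := Iff.rfl

lemma isClosed_approxData : IsClosed (D.approxData : Set C(frontier D.Ω, ℂ)) := by
  have : (D.approxData : Set C(frontier D.Ω, ℂ)) =
      ⋂ c : ℂ, (fun f => D.reData (c • f)) ⁻¹' D.solvable.topologicalClosure := by
    ext f
    simp only [mem_iInter, mem_preimage, SetLike.mem_coe, mem_approxData]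
  rw [this]
  refine isClosed_iInter fun c => IsClosed.preimage ?_ D.solvable.isClosed_topologicalClosure
  exact D.reData.continuous.comp (continuous_const_smul c)

/-- The Cauchy kernel as boundary data. -/
def cauchyKernel (b : ℂ) (hb : b ∉ frontier D.Ω) : C(frontier D.Ω, ℂ) :=
  ⟨fun ζ => (b - ζ)⁻¹, Continuous.inv₀ (by fun_prop) fun ζ h => hb (by
    rw [sub_eq_zero.1 h]; exact ζ.2)⟩

lemma abs_log_norm_sub_add_le {b c ζ : ℂ} (hc : ‖c‖ ≤ ‖ζ - b‖ / 2) (hζ : ζ ≠ b) :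
    |Real.log ‖ζ - (b + c)‖ - Real.log ‖ζ - b‖ - (c * (b - ζ)⁻¹).re| ≤ ‖c‖ ^ 2 / ‖ζ - b‖ ^ 2 := by
  have h0 : 0 < ‖ζ - b‖ := norm_pos_iff.2 (sub_ne_zero.2 hζ)
  have h1 : ζ - b ≠ 0 := sub_ne_zero.2 hζ
  have h2 : b - ζ ≠ 0 := sub_ne_zero.2 hζ.symm
  set x : ℂ := c * (b - ζ)⁻¹ with hx
  have hxn : ‖x‖ = ‖c‖ / ‖ζ - b‖ := by
    rw [hx, norm_mul, norm_inv, norm_sub_rev b, div_eq_mul_inv]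
  have hx2 : ‖x‖ ≤ 1 / 2 := by
    rw [hxn, div_le_iff₀ h0]; linarith
  have hlog := log_norm_sub_eq_re (a := b) (b := b + c) (ζ := ζ) (by rw [add_sub_cancel_left]; linarith)
  have hxe : 1 - (b + c - b) / (ζ - b) = 1 + x := by
    rw [hx]; field_simp; ring
  rw [hlog, hxe, add_re, ofReal_re]
  have := norm_log_one_add_sub_self_le (z := x) (by linarith)
  have hinv : (1 - ‖x‖)⁻¹ ≤ 2 := by
    rw [inv_le_comm₀ (by linarith) (by norm_num)]; linarith
  calc |Real.log ‖ζ - b‖ + (log (1 + x)).re - Real.log ‖ζ - b‖ - x.re|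
      = |(log (1 + x) - x).re| := by rw [sub_re]; congr 1; ring
    _ ≤ ‖log (1 + x) - x‖ := abs_re_le_norm _
    _ ≤ ‖x‖ ^ 2 * (1 - ‖x‖)⁻¹ / 2 := this
    _ ≤ ‖x‖ ^ 2 * 2 / 2 := by gcongr
    _ = ‖c‖ ^ 2 / ‖ζ - b‖ ^ 2 := by rw [hxn, div_pow]; ring

lemma cauchyKernel_mem_approxData {b : ℂ} (hb : b ∉ frontier D.Ω) :
    D.cauchyKernel b hb ∈ D.approxData := by
  intro c
  obtain ⟨d, hd, hdb⟩ : ∃ d > 0, ball b d ⊆ (frontier D.Ω)ᶜ :=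
    Metric.isOpen_iff.1 isClosed_frontier.isOpen_compl b hb
  have hfar : ∀ ζ ∈ frontier D.Ω, d ≤ ‖ζ - b‖ := by
    intro ζ hζ
    by_contra h
    exact hdb (by rw [mem_ball, dist_eq_norm]; linarith : ζ ∈ ball b d) hζ
  rw [← SetLike.mem_coe, Submodule.topologicalClosure_coe, Metric.mem_closure_iff]
  intro ε hε
  set C := ‖c‖ + 1 with hC
  have hC0 : 0 < C := by positivity
  set t : ℝ := min (d / (2 * C)) (ε * d ^ 2 / (2 * C ^ 2)) with ht
  have ht0 : 0 < t := by positivity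
  have htc : ‖(t : ℂ) * c‖ ≤ d / 2 := by
    rw [norm_mul, norm_real, Real.norm_of_nonneg ht0.le]
    calc t * ‖c‖ ≤ d / (2 * C) * C := by
          gcongr
          · exact min_le_left _ _
          · linarith
      _ = d / 2 := by field_simp
  have hbt : b + t * c ∉ frontier D.Ω := by
    refine hdb ?_
    rw [mem_ball, dist_eq_norm, add_sub_cancel_left]
    linarith
  refine ⟨t⁻¹ • (D.logKernel (b + t * c) hbt - D.logKernel b hb),
    Submodule.smul_mem _ _ (sub_mem (D.logKernel_mem_solvable _) (D.logKernel_mem_solvable _)), ?_⟩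
  refine lt_of_le_of_lt ((ContinuousMap.dist_le (by positivity : 0 ≤ ε / 2)).2 fun ζ => ?_)
    (half_lt_self hε)
  have hζ := hfar ζ ζ.2
  have hne : (ζ : ℂ) ≠ b := fun h => hb (h ▸ ζ.2)
  have h1 := abs_log_norm_sub_add_le (b := b) (c := t * c) (ζ := ζ) (by linarith) hne
  rw [dist_comm, Real.dist_eq]
  change |t⁻¹ * (Real.log ‖(ζ : ℂ) - (b + t * c)‖ - Real.log ‖(ζ : ℂ) - b‖) -
    (c * (b - ζ)⁻¹).re| ≤ ε / 2
  have h2 : ((t : ℂ) * c * (b - ζ)⁻¹).re = t * (c * (b - ζ)⁻¹).re := by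
    rw [mul_assoc, re_ofReal_mul]
  rw [h2] at h1
  have h3 : t⁻¹ * (Real.log ‖(ζ : ℂ) - (b + t * c)‖ - Real.log ‖(ζ : ℂ) - b‖) -
      (c * (b - ζ)⁻¹).re = t⁻¹ * (Real.log ‖(ζ : ℂ) - (b + t * c)‖ - Real.log ‖(ζ : ℂ) - b‖ -
      t * (c * (b - ζ)⁻¹).re) := by field_simp
  rw [h3, abs_mul, abs_of_pos (inv_pos.2 ht0)]
  calc t⁻¹ * _ ≤ t⁻¹ * (‖(t : ℂ) * c‖ ^ 2 / ‖(ζ : ℂ) - b‖ ^ 2) := by gcongr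
    _ = t * ‖c‖ ^ 2 / ‖(ζ : ℂ) - b‖ ^ 2 := by
        rw [norm_mul, norm_real, Real.norm_of_nonneg ht0.le]; field_simp
    _ ≤ (ε * d ^ 2 / (2 * C ^ 2)) * C ^ 2 / d ^ 2 := by
        gcongr
        · exact min_le_right _ _
        · linarith
    _ = ε / 2 := by field_simp

/-- Circle integrals of Cauchy kernels are approximable boundary data. -/
lemma exists_approxData_circleIntegral {γ h : ℂ → ℂ} {s : ℝ} (hs : 0 ≤ s)
    (hγ : ContinuousOn γ (sphere 0 s)) (hh : ContinuousOn h (sphere 0 s))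
    (hoff : ∀ σ ∈ sphere (0 : ℂ) s, γ σ ∉ frontier D.Ω) :
    ∃ f ∈ D.approxData, ∀ ζ : frontier D.Ω, f ζ = ∮ z in C(0, s), h z / (γ z - ζ) := by
  have hcm : ∀ θ, circleMap 0 s θ ∈ sphere (0 : ℂ) s := circleMap_mem_sphere 0 hs
  have hγc : Continuous fun θ => γ (circleMap 0 s θ) :=
    hγ.comp_continuous (continuous_circleMap 0 s) hcm
  have hhc : Continuous fun θ => h (circleMap 0 s θ) :=
    hh.comp_continuous (continuous_circleMap 0 s) hcm
  let G : C(ℝ × frontier D.Ω, ℂ) :=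
    ⟨fun p => deriv (circleMap 0 s) p.1 * h (circleMap 0 s p.1) *
      (γ (circleMap 0 s p.1) - p.2)⁻¹, by
      have hd : Continuous (deriv (circleMap 0 s)) := by
        simp only [funext (deriv_circleMap 0 s)]
        fun_prop
      refine ((hd.comp continuous_fst).mul (hhc.comp continuous_fst)).mul (Continuous.inv₀ ?_ ?_)
      · exact (hγc.comp continuous_fst).sub (continuous_subtype_val.comp continuous_snd)
      · rintro ⟨θ, ζ⟩ h0
        exact hoff _ (hcm θ) (by rw [sub_eq_zero.1 h0]; exact ζ.2)⟩
  have hmem : ∀ θ, G.curry θ ∈ D.approxData := by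
    intro θ
    have : G.curry θ = (deriv (circleMap 0 s) θ * h (circleMap 0 s θ)) •
        D.cauchyKernel (γ (circleMap 0 s θ)) (hoff _ (hcm θ)) := rfl
    rw [this]
    exact Submodule.smul_mem _ _ (D.cauchyKernel_mem_approxData _)
  have : CompleteSpace D.approxData := D.isClosed_approxData.completeSpace_coe
  let F : ℝ → D.approxData := fun θ => ⟨G.curry θ, hmem θ⟩
  have hF : Continuous F := G.curry.continuous.subtype_mk _
  refine ⟨(∫ θ in (0 : ℝ)..2 * Real.pi, F θ : D.approxData), Subtype.coe_prop _, fun ζ => ?_⟩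
  let L : D.approxData →L[ℝ] ℂ :=
    ((ContinuousMap.evalCLM ℂ ζ).comp D.approxData.subtypeL).restrictScalars ℝ
  have hL := L.intervalIntegral_comp_comm (hF.intervalIntegrable (μ := volume) 0 (2 * Real.pi))
  change L (∫ θ in (0 : ℝ)..2 * Real.pi, F θ) = _
  rw [← hL, circleIntegral]
  refine intervalIntegral.integral_congr fun θ _ => ?_
  change deriv (circleMap 0 s) θ * h (circleMap 0 s θ) * (γ (circleMap 0 s θ) - ζ)⁻¹ = _
  rw [smul_eq_mul, div_eq_mul_inv, mul_assoc]

/-- Powers of the uniformizer of a boundary component, extended by zero, are approximable. -/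
lemma exists_approxData_zpow {γ : ℂ → ℂ} {R : ℝ} (j : Fin (n + 1)) (hR : 1 < R)
    (hγ : IsAnnulusEmbedding γ R⁻¹ R) (him : γ '' sphere 0 1 = D.Γ j)
    (hoff : ∀ σ ∈ openAnnulus R⁻¹ R, ‖σ‖ ≠ 1 → γ σ ∉ frontier D.Ω) (k : ℤ) :
    ∃ f ∈ D.approxData, (∀ ζ : frontier D.Ω, ∀ τ : ℂ, ‖τ‖ = 1 → γ τ = ζ → f ζ = τ ^ k) ∧
      ∀ ζ : frontier D.Ω, (ζ : ℂ) ∉ D.Γ j → f ζ = 0 := by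
  have hR0 : 0 < R := by linarith
  have hRi : R⁻¹ < 1 := inv_lt_one_of_one_lt₀ hR
  obtain ⟨s, hs, hs1⟩ := exists_between hRi
  obtain ⟨t, ht1, ht⟩ := exists_between hR
  have hs0 : 0 < s := (inv_pos.2 hR0).trans hs
  have hpow : DifferentiableOn ℂ (fun z : ℂ => z ^ k) (openAnnulus R⁻¹ R) := fun z hz =>
    (differentiableAt_zpow.2 (Or.inl (norm_pos_iff.1
      ((inv_pos.2 hR0).trans hz.1)))).differentiableWithinAt
  have hnum : DifferentiableOn ℂ (fun z => z ^ k * deriv γ z) (openAnnulus R⁻¹ R) :=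
    hpow.mul hγ.differentiableOn_deriv
  have key : ∀ ρ, R⁻¹ < ρ → ρ < R → ρ ≠ 1 → ∃ f ∈ D.approxData, ∀ ζ : frontier D.Ω,
      f ζ = ∮ z in C(0, ρ), z ^ k * deriv γ z / (γ z - ζ) := by
    intro ρ h1 h2 h3
    have hsub := sphere_subset_openAnnulus h1 h2
    refine D.exists_approxData_circleIntegral ((inv_pos.2 hR0).trans h1).le
      (hγ.diff.continuousOn.mono hsub) (hnum.continuousOn.mono hsub)
      fun σ hσ => hoff σ (hsub hσ) ?_
    rwa [mem_sphere_zero_iff_norm.1 hσ]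
  obtain ⟨ft, hft, hft'⟩ := key t (by linarith) ht ht1.ne'
  obtain ⟨fs, hfs, hfs'⟩ := key s hs (by linarith) hs1.ne
  refine ⟨(2 * Real.pi * I : ℂ)⁻¹ • (ft - fs), Submodule.smul_mem _ _ (sub_mem hft hfs), ?_, ?_⟩
  · intro ζ τ hτ hζ
    have := hγ.circleIntegral_sub (inv_pos.2 hR0).le hpow (τ := τ) (s := s) (t := t) hs
      (by linarith) (by linarith) ht
    rw [ContinuousMap.smul_apply, ContinuousMap.sub_apply, hft', hfs', ← hζ, this, smul_eq_mul,
      inv_mul_cancel_left₀ two_pi_I_ne_zero]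
  · intro ζ hζ
    have hd : DifferentiableOn ℂ (fun z => z ^ k * deriv γ z / (γ z - ζ)) (openAnnulus R⁻¹ R) := by
      refine hnum.div (hγ.diff.sub_const _) fun z hz h0 => ?_
      have hz0 := sub_eq_zero.1 h0
      by_cases hz1 : ‖z‖ = 1
      · exact hζ (by rw [← him, ← hz0]; exact ⟨z, by simpa using hz1, rfl⟩)
      · exact hoff z hz hz1 (by rw [hz0]; exact ζ.2)
    rw [ContinuousMap.smul_apply, ContinuousMap.sub_apply, hft', hfs',
      circleIntegral_eq_of_differentiableOn_openAnnulus (inv_pos.2 hR0).le hd hs (by linarith) ht,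
      sub_self, smul_zero]

lemma approxData_eq_top : D.approxData = ⊤ := by
  choose γ R hR hγ him hoff using D.exists_annulusEmbedding
  choose e he heτ he0 using fun j k =>
    D.exists_approxData_zpow j (hR j) (hγ j) (him j) (hoff j) k
  have hpar : ∀ ζ : frontier D.Ω, ∃ j τ, ‖τ‖ = 1 ∧ γ j τ = ζ := by
    intro ζ
    obtain ⟨j, hj⟩ := mem_iUnion.1 (D.frontier_eq.subset ζ.2)
    rw [← him j] at hj
    obtain ⟨τ, hτ, h⟩ := hj
    exact ⟨j, τ, by simpa using hτ, h⟩
  have hoffj : ∀ i j τ, ‖τ‖ = 1 → i ≠ j → ∀ ζ : frontier D.Ω, γ j τ = ζ → ∀ k, e i k ζ = 0 := by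
    intro i j τ hτ hij ζ hζ k
    refine he0 i k ζ fun hi => (D.disj i j hij).le_bot ⟨hi, ?_⟩
    rw [← hζ, ← him j]
    exact ⟨τ, by simpa using hτ, rfl⟩
  let M : Submonoid C(frontier D.Ω, ℂ) :=
    { carrier := {f | f = 0 ∨ f = 1 ∨ ∃ j k, f = e j k}
      one_mem' := Or.inr (Or.inl rfl)
      mul_mem' := by
        rintro f g (rfl | rfl | ⟨j, k, rfl⟩) hg
        · exact Or.inl (zero_mul _)
        · rwa [one_mul]
        · rcases hg with rfl | rfl | ⟨i, l, rfl⟩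
          · exact Or.inl (mul_zero _)
          · exact Or.inr (Or.inr ⟨j, k, mul_one _⟩)
          · by_cases hij : i = j
            · subst hij
              refine Or.inr (Or.inr ⟨i, k + l, ?_⟩)
              ext ζ
              obtain ⟨m, τ, hτ, hζ⟩ := hpar ζ
              by_cases him' : i = m
              · subst him'
                rw [ContinuousMap.mul_apply, heτ i _ ζ τ hτ hζ, heτ i _ ζ τ hτ hζ,
                  heτ i _ ζ τ hτ hζ, zpow_add₀ (norm_ne_zero_iff.1 (by rw [hτ]; norm_num))]
              · rw [ContinuousMap.mul_apply, hoffj i m τ hτ him' ζ hζ,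
                  hoffj i m τ hτ him' ζ hζ, zero_mul, hoffj i m τ hτ him' ζ hζ]
            · refine Or.inl ?_
              ext ζ
              obtain ⟨m, τ, hτ, hζ⟩ := hpar ζ
              by_cases him' : i = m
              · subst him'
                rw [ContinuousMap.mul_apply, hoffj j i τ hτ (Ne.symm hij) ζ hζ, zero_mul]; rfl
              · rw [ContinuousMap.mul_apply, hoffj i m τ hτ him' ζ hζ, mul_zero]; rfl }
  have hstar : ∀ f ∈ M, star f ∈ M := by
    rintro f (rfl | rfl | ⟨j, k, rfl⟩)
    · exact Or.inl (star_zero _)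
    · exact Or.inr (Or.inl (star_one _))
    · refine Or.inr (Or.inr ⟨j, -k, ?_⟩)
      ext ζ
      obtain ⟨m, τ, hτ, hζ⟩ := hpar ζ
      rw [ContinuousMap.star_apply]
      by_cases hjm : j = m
      · subst hjm
        rw [heτ j _ ζ τ hτ hζ, heτ j _ ζ τ hτ hζ, zpow_neg, ← inv_zpow, RCLike.star_def,
          map_zpow₀]
        congr 1
        rw [Complex.inv_def, normSq_eq_norm_sq, hτ]
        simp
      · rw [hoffj j m τ hτ hjm ζ hζ, hoffj j m τ hτ hjm ζ hζ, star_zero]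
  let A : StarSubalgebra ℂ C(frontier D.Ω, ℂ) := StarAlgebra.adjoin ℂ (M : Set C(frontier D.Ω, ℂ))
  have hA : A.topologicalClosure = ⊤ := by
    refine ContinuousMap.starSubalgebra_topologicalClosure_eq_top_of_separatesPoints A ?_
    intro x y hxy
    obtain ⟨j, τ, hτ, hx⟩ := hpar x
    obtain ⟨i, σ, hσ, hy⟩ := hpar y
    have hmem : ∀ j k, e j k ∈ A := fun j k =>
      StarAlgebra.subset_adjoin ℂ _ (Or.inr (Or.inr ⟨j, k, rfl⟩))
    by_cases hij : j = i
    · subst hij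
      refine ⟨e j 1, ⟨e j 1, hmem j 1, rfl⟩, ?_⟩
      rw [heτ j _ x τ hτ hx, heτ j _ y σ hσ hy, zpow_one, zpow_one]
      rintro rfl
      exact hxy (Subtype.ext (hx.symm.trans hy))
    · refine ⟨e j 0, ⟨e j 0, hmem j 0, rfl⟩, ?_⟩
      rw [heτ j _ x τ hτ hx, hoffj j i σ hσ hij y hy, zpow_zero]
      exact one_ne_zero
  have hone : (1 : C(frontier D.Ω, ℂ)) ∈ D.approxData := by
    have : (1 : C(frontier D.Ω, ℂ)) = ∑ j, e j 0 := by
      ext ζ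
      obtain ⟨m, τ, hτ, hζ⟩ := hpar ζ
      rw [ContinuousMap.sum_apply, Finset.sum_eq_single m, heτ m _ ζ τ hτ hζ, zpow_zero]
      · rfl
      · intro i _ him'
        exact hoffj i m τ hτ him' ζ hζ 0
      · simp
    rw [this]
    exact Submodule.sum_mem _ fun j _ => he j 0
  have hsub : (A : Set C(frontier D.Ω, ℂ)) ⊆ D.approxData := by
    intro f hf
    have hf' : f ∈ Algebra.adjoin ℂ (M : Set C(frontier D.Ω, ℂ)) := by
      have h1 : f ∈ A.toSubalgebra := hf
      rw [StarAlgebra.adjoin_toSubalgebra] at h1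
      have h2 : (M : Set C(frontier D.Ω, ℂ)) ∪ star (M : Set C(frontier D.Ω, ℂ)) = M := by
        refine union_eq_left.2 fun g hg => ?_
        simpa using hstar _ (Set.mem_star.1 hg)
      rwa [h2] at h1
    rw [← Subalgebra.mem_toSubmodule, Algebra.adjoin_eq_span, Submonoid.closure_eq] at hf'
    refine (Submodule.span_le (p := D.approxData)).2 ?_ hf'
    rintro g (rfl | rfl | ⟨j, k, rfl⟩)
    · exact zero_mem _
    · exact hone
    · exact he j k
  rw [eq_top_iff]
  intro f _
  have hf : f ∈ A.topologicalClosure := hA ▸ StarSubalgebra.mem_top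
  exact closure_minimal hsub D.isClosed_approxData hf

/-- Continuous boundary data are uniformly approximable by boundary values of harmonic functions
continuous up to the boundary. -/
lemma exists_harmonic_approx {g : ℂ → ℝ} (hg : ContinuousOn g (frontier D.Ω)) {ε : ℝ}
    (hε : 0 < ε) : ∃ u : ℂ → ℝ, ContinuousOn u (closure D.Ω) ∧ IsHarmonicOn u D.Ω ∧
      ∀ ζ ∈ frontier D.Ω, |u ζ - g ζ| ≤ ε := by
  let G : C(frontier D.Ω, ℝ) := ⟨fun ζ => g ζ, continuousOn_iff_continuous_domRestrict.1 hg⟩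
  let G' : C(frontier D.Ω, ℂ) := ⟨fun ζ => (G ζ : ℂ), by fun_prop⟩
  have h1 : G' ∈ D.approxData := by rw [D.approxData_eq_top]; trivial
  have h2 : D.reData ((1 : ℂ) • G') = G := by
    ext ζ
    rw [one_smul, reData_apply]
    exact ofReal_re _
  have h3 := h1 1
  rw [h2, ← SetLike.mem_coe, Submodule.topologicalClosure_coe, Metric.mem_closure_iff] at h3
  obtain ⟨v, ⟨u, hu, hu', huv⟩, hv⟩ := h3 ε hε
  refine ⟨u, hu, hu', fun ζ hζ => ?_⟩
  have := (ContinuousMap.dist_apply_le_dist (f := G) (g := v) ⟨ζ, hζ⟩).trans hv.le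
  rw [dist_comm, Real.dist_eq, ← huv] at this
  exact this

end MCDomain

/-! ### The Harnack inequality -/

lemma IsHarmonicOn.le_two_mul {u : ℂ → ℝ} {z₀ z : ℂ} {R : ℝ} (hu : IsHarmonicOn u (ball z₀ R))
    (hpos : ∀ z ∈ ball z₀ R, 0 ≤ u z) (hz : ‖z - z₀‖ < R / 3) : u z ≤ 2 * u z₀ := by
  have hR : 0 < R := by linarith [norm_nonneg (z - z₀)]
  have hharm : InnerProductSpace.HarmonicOnNhd u (ball z₀ R) := by
    intro w hw
    obtain ⟨r, hr, -, g, hg, hug⟩ := hu w hw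
    have ha : AnalyticAt ℂ g w := hg.analyticAt (isOpen_ball.mem_nhds (mem_ball_self hr))
    refine (InnerProductSpace.harmonicAt_congr_nhds ?_).1 ha.harmonicAt_re
    filter_upwards [isOpen_ball.mem_nhds (mem_ball_self hr)] with x hx using (hug x hx).symm
  obtain ⟨F, hF, hFu⟩ := hharm.exists_analyticOnNhd_ball_re_eq
  have hmaps : ∀ x ∈ ball (0 : ℂ) R, z₀ + x ∈ ball z₀ R := by
    intro x hx
    simpa [dist_eq_norm] using hx
  have hz₀ : z₀ ∈ ball z₀ R := mem_ball_self hR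
  have hzR : z ∈ ball z₀ R := by rw [mem_ball, dist_eq_norm]; linarith
  refine le_of_forall_pos_le_add fun ε hε => ?_
  have hM : 0 < u z₀ + ε := by linarith [hpos z₀ hz₀]
  have key := borelCaratheodory_zero (f := fun x => F z₀ - F (z₀ + x)) (R := R) (M := u z₀ + ε)
    (z := z - z₀) hM ?_ ?_ hR (by rw [mem_ball_zero_iff]; linarith) (by simp)
  · have h1 : 2 * (u z₀ + ε) * ‖z - z₀‖ / (R - ‖z - z₀‖) ≤ u z₀ + ε := by
      rw [div_le_iff₀ (by linarith)]
      nlinarith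
    have h2 := (abs_re_le_norm _).trans (key.trans h1)
    rw [add_sub_cancel, sub_re] at h2
    have e1 : (F z₀).re = u z₀ := hFu hz₀
    have e2 : (F z).re = u z := hFu hzR
    rw [e1, e2] at h2
    linarith [neg_abs_le (u z₀ - u z)]
  · intro x hx
    have : DifferentiableAt ℂ F (z₀ + x) := (hF _ (hmaps x hx)).differentiableAt
    exact ((this.comp x (by fun_prop : DifferentiableAt ℂ (fun x => z₀ + x) x)).const_sub
      _).differentiableWithinAt
  · intro x hx
    have e1 : (F z₀).re = u z₀ := hFu hz₀
    have e2 : (F (z₀ + x)).re = u (z₀ + x) := hFu (hmaps x hx)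
    change (F z₀ - F (z₀ + x)).re ≤ _
    rw [sub_re, e1, e2]
    linarith [hpos _ (hmaps x hx)]

lemma IsHarmonicOn.mono {u : ℂ → ℝ} {U V : Set ℂ} (hu : IsHarmonicOn u U) (hV : IsOpen V)
    (h : V ⊆ U) : IsHarmonicOn u V := by
  intro z hz
  obtain ⟨r, hr, -, g, hg, hug⟩ := hu z (h hz)
  obtain ⟨s, hs, hsV⟩ := Metric.isOpen_iff.1 hV z hz
  have h1 : ball z (min r s) ⊆ ball z r := ball_subset_ball (min_le_left _ _)
  exact ⟨min r s, lt_min hr hs, (ball_subset_ball (min_le_right _ _)).trans hsV, g, hg.mono h1,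
    fun w hw => hug w (h1 hw)⟩

lemma exists_harnack_const {U : Set ℂ} (hU : IsOpen U) (hconn : IsPreconnected U) {z w : ℂ}
    (hz : z ∈ U) (hw : w ∈ U) : ∃ C : ℝ, 0 ≤ C ∧ ∀ u : ℂ → ℝ, IsHarmonicOn u U →
      (∀ x ∈ U, 0 ≤ u x) → u z ≤ C * u w := by
  set S : Set ℂ := {z | z ∈ U ∧ ∃ C : ℝ, 0 ≤ C ∧ ∀ u : ℂ → ℝ, IsHarmonicOn u U →
      (∀ x ∈ U, 0 ≤ u x) → u z ≤ C * u w} with hS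
  have step : ∀ x ∈ S, ∀ y R, ball x R ⊆ U → ‖y - x‖ < R / 3 → y ∈ S := by
    rintro x ⟨hx, C, hC, hCu⟩ y R hR hy
    refine ⟨hR ?_, 2 * C, by positivity, fun u hu hpos => ?_⟩
    · rw [mem_ball, dist_eq_norm]; linarith [norm_nonneg (y - x)]
    · have := (hu.mono isOpen_ball hR).le_two_mul (fun t ht => hpos t (hR ht)) hy
      linarith [hCu u hu hpos]
  have hopen : IsOpen S := by
    rw [Metric.isOpen_iff]
    intro x hx
    obtain ⟨R, hR, hRU⟩ := Metric.isOpen_iff.1 hU x hx.1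
    refine ⟨R / 3, by positivity, fun y hy => step x hx y R hRU ?_⟩
    rwa [mem_ball, dist_eq_norm] at hy
  have hsub := hconn.subset_of_closure_inter_subset hopen
    ⟨w, hw, hw, 1, zero_le_one, fun u _ _ => by rw [one_mul]⟩ ?_
  · exact (hsub hz).2
  · rintro x ⟨hxc, hxU⟩
    obtain ⟨R, hR, hRU⟩ := Metric.isOpen_iff.1 hU x hxU
    obtain ⟨y, hy, hxy⟩ := Metric.mem_closure_iff.1 hxc (R / 8) (by positivity)
    refine step y hy x (R / 2) (fun t ht => hRU ?_) ?_
    · rw [mem_ball] at ht ⊢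
      rw [dist_comm] at hxy
      linarith [dist_triangle t y x]
    · rw [dist_eq_norm] at hxy; linarith

namespace MCDomain

variable (D : MCDomain n)

lemma abs_integral_sub_le {u g : ℂ → ℝ} (hu : ContinuousOn u (closure D.Ω))
    (hu' : IsHarmonicOn u D.Ω) (hg : ContinuousOn g (frontier D.Ω)) {ε : ℝ}
    (hug : ∀ ζ ∈ frontier D.Ω, |u ζ - g ζ| ≤ ε) {b : ℂ} (hb : b ∈ D.Ω) :
    |u b - ∫ ζ, g ζ ∂D.ωm b| ≤ ε := by
  have := D.prob b hb
  rw [D.dirichlet u hu hu' b hb, ← integral_sub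
    (D.integrable_of_continuousOn hb (hu.mono frontier_subset_closure))
    (D.integrable_of_continuousOn hb hg), ← Real.norm_eq_abs]
  refine (norm_integral_le_of_norm_le_const (C := ε) ?_).trans (by simp)
  filter_upwards [D.ae_mem_frontier hb] with ζ hζ using hug ζ hζ

lemma continuousOn_integral {g : ℂ → ℝ} (hg : ContinuousOn g (frontier D.Ω)) :
    ContinuousOn (fun b => ∫ ζ, g ζ ∂D.ωm b) D.Ω := by
  refine continuousOn_of_uniform_approx_of_continuousOn fun t ht => ?_
  obtain ⟨ε, hε, hεt⟩ := Metric.mem_uniformity_dist.1 ht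
  obtain ⟨u, hu, hu', hug⟩ := D.exists_harmonic_approx hg (half_pos hε)
  refine ⟨u, hu'.continuousOn, fun b hb => hεt ?_⟩
  rw [dist_comm, Real.dist_eq]
  exact (D.abs_integral_sub_le hu hu' hg hug hb).trans_lt (half_lt_self hε)

lemma exists_integral_le {z w : ℂ} (hz : z ∈ D.Ω) (hw : w ∈ D.Ω) :
    ∃ C : ℝ, 0 ≤ C ∧ ∀ g : ℂ → ℝ, ContinuousOn g (frontier D.Ω) →
      (∀ ζ ∈ frontier D.Ω, 0 ≤ g ζ) → ∫ ζ, g ζ ∂D.ωm z ≤ C * ∫ ζ, g ζ ∂D.ωm w := by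
  obtain ⟨C, hC, hCu⟩ := exists_harnack_const D.isOpen D.conn.isPreconnected hz hw
  refine ⟨C, hC, fun g hg hpos => le_of_forall_pos_le_add fun δ hδ => ?_⟩
  set ε := δ / (2 * (C + 1)) with hε
  have hε0 : 0 < ε := by positivity
  obtain ⟨u, hu, hu', hug⟩ := D.exists_harmonic_approx hg hε0
  have h0 : ∀ x ∈ D.Ω, 0 ≤ u x + ε := by
    intro x hx
    have h1 := abs_le.1 (D.abs_integral_sub_le hu hu' hg hug hx)
    have h2 : 0 ≤ ∫ ζ, g ζ ∂D.ωm x :=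
      integral_nonneg_of_ae ((D.ae_mem_frontier hx).mono hpos)
    linarith
  have h1 := hCu _ (hu'.add (isHarmonicOn_const D.isOpen ε)) h0
  have h2 := abs_le.1 (D.abs_integral_sub_le hu hu' hg hug hz)
  have h3 := abs_le.1 (D.abs_integral_sub_le hu hu' hg hug hw)
  have h4 : ε * (2 * (C + 1)) = δ := by rw [hε]; field_simp
  nlinarith

lemma exists_measure_le {z w : ℂ} (hz : z ∈ D.Ω) (hw : w ∈ D.Ω) :
    ∃ C : ℝ≥0∞, C ≠ ∞ ∧ D.ωm z ≤ C • D.ωm w := by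
  have := D.prob z hz
  have := D.prob w hw
  obtain ⟨C, hC, hCg⟩ := D.exists_integral_le hz hw
  refine ⟨ENNReal.ofReal C, ENNReal.ofReal_ne_top, ?_⟩
  have hclosed : ∀ F : Set ℂ, IsClosed F → D.ωm z F ≤ ENNReal.ofReal C * D.ωm w F := by
    intro F hF
    refine le_of_tendsto_of_tendsto' (HasOuterApproxClosed.tendsto_lintegral_apprSeq hF (D.ωm z))
      (ENNReal.Tendsto.const_mul (HasOuterApproxClosed.tendsto_lintegral_apprSeq hF (D.ωm w))
        (Or.inr ENNReal.ofReal_ne_top)) fun k => ?_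
    have hfin : ∀ x ∈ D.Ω, ∫⁻ ζ, (hF.apprSeq k ζ : ℝ≥0∞) ∂D.ωm x =
        ENNReal.ofReal (∫ ζ, (hF.apprSeq k ζ : ℝ) ∂D.ωm x) := by
      intro x hx
      have := D.prob x hx
      rw [← BoundedContinuousFunction.toReal_lintegral_coe_eq_integral, ENNReal.ofReal_toReal]
      exact (BoundedContinuousFunction.lintegral_lt_top_of_nnreal _ _).ne
    rw [hfin z hz, hfin w hw, ← ENNReal.ofReal_mul hC]
    exact ENNReal.ofReal_le_ofReal (hCg _ (by fun_prop) fun ζ _ => NNReal.coe_nonneg _)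
  refine Measure.le_iff.2 fun S hS => ?_
  rw [hS.measure_eq_iSup_isClosed_of_ne_top (measure_ne_top _ _)]
  refine iSup₂_le fun F hFS => iSup_le fun hF => (hclosed F hF).trans ?_
  rw [Measure.smul_apply, smul_eq_mul]
  gcongr

lemma absolutelyContinuous {z w : ℂ} (hz : z ∈ D.Ω) (hw : w ∈ D.Ω) : D.ωm z ≪ D.ωm w := by
  obtain ⟨C, -, hC⟩ := D.exists_measure_le hz hw
  exact Measure.absolutelyContinuous_of_le_smul hC

/-- Harmonic measure concentrates near the pole as the pole approaches the boundary. -/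
lemma exists_measureReal_far_le {η : ℝ} (hη : 0 < η) :
    ∃ a > 1, ∃ r > 0, ∀ b ∈ D.Ω, D.bdist b < r →
      (D.ωm b).real {ζ | ζ ∈ frontier D.Ω ∧ a * D.bdist b ≤ ‖b - ζ‖} ≤ η := by
  obtain ⟨r, hr, href⟩ := D.exists_reflection (ε := 1) one_pos
  have hlog6 : 0 < Real.log 6 := Real.log_pos (by norm_num)
  set L := Real.log 6 / η with hL
  have hL0 : 0 < L := by positivity
  refine ⟨Real.exp L, Real.one_lt_exp_iff.2 hL0, r, hr, fun b hb hbr => ?_⟩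
  have := D.prob b hb
  obtain ⟨b', hb', hζ⟩ := href b hb hbr
  set d := D.bdist b with hd
  have hd0 : 0 < d := D.bdist_pos hb
  obtain ⟨ζ₀, hζ₀, hζ₀d⟩ := D.exists_frontier_dist_eq hb
  have hbb : ‖b - b'‖ ≤ 3 * d := by
    have h1 := (hζ ζ₀ hζ₀).2
    have h2 := norm_sub_le_norm_sub_add_norm_sub b ζ₀ b'
    rw [norm_sub_rev ζ₀ b, hζ₀d] at h1
    rw [hζ₀d] at h2
    linarith
  have hb'f : b' ∉ frontier D.Ω := fun h => hb' (frontier_subset_closure h)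
  have hbb0 : 0 < ‖b - b'‖ :=
    norm_pos_iff.2 (sub_ne_zero.2 fun h => hb' (h ▸ subset_closure hb))
  set F : ℂ → ℝ := fun ζ => Real.log ‖ζ - b'‖ - Real.log (d / 2) with hF
  have hlow : ∀ ζ ∈ frontier D.Ω, ∀ c : ℝ, 0 < c → c * d ≤ ‖b - ζ‖ → Real.log c ≤ F ζ := by
    intro ζ hζf c hc hcd
    have h1 := (hζ ζ hζf).1
    rw [norm_sub_rev ζ b] at h1
    have h2 : c * (d / 2) ≤ ‖ζ - b'‖ := by linarith
    have h3 := Real.log_le_log (by positivity) h2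
    rw [Real.log_mul hc.ne' (by positivity)] at h3
    simp only [hF]; linarith
  have h_int := D.integrable_of_continuousOn hb (continuousOn_log_norm_sub hb'f)
  have hFint : Integrable F (D.ωm b) := h_int.sub (integrable_const _)
  have hFnn : 0 ≤ᵐ[D.ωm b] F := by
    filter_upwards [D.ae_mem_frontier hb] with ζ hζf
    have := hlow ζ hζf 1 one_pos (by rw [one_mul]; exact D.bdist_le hζf)
    simpa using this
  have hFI : ∫ ζ, F ζ ∂D.ωm b ≤ Real.log 6 := by
    simp only [hF]
    rw [integral_sub h_int (integrable_const _)]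
    have h1 : ∫ ζ, Real.log ‖ζ - b'‖ ∂D.ωm b = Real.log ‖b - b'‖ :=
      D.potential_of_notMem_closure hb hb'
    rw [h1]
    simp only [integral_const, probReal_univ, one_smul]
    rw [← Real.log_div hbb0.ne' (by positivity)]
    refine Real.log_le_log (by positivity) ?_
    rw [div_le_iff₀ (by positivity)]
    linarith
  have hM := mul_meas_ge_le_integral_of_nonneg hFnn hFint L
  have hsub : (D.ωm b).real {ζ | ζ ∈ frontier D.Ω ∧ Real.exp L * d ≤ ‖b - ζ‖} ≤
      (D.ωm b).real {ζ | L ≤ F ζ} := by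
    refine measureReal_mono ?_
    rintro ζ ⟨hζf, hζa⟩
    have := hlow ζ hζf _ (Real.exp_pos L) hζa
    rwa [Real.log_exp] at this
  refine hsub.trans ?_
  have h5 : L * η = Real.log 6 := by rw [hL]; field_simp
  nlinarith

end MCDomain

/-! ### Moduli of multivalued analytic functions -/

/-- `V` is locally the modulus of a holomorphic function on `U`. -/
def IsModulusOn (V : ℂ → ℝ) (U : Set ℂ) : Prop :=
  ∀ z ∈ U, ∃ r > 0, ball z r ⊆ U ∧ ∃ g : ℂ → ℂ,
    DifferentiableOn ℂ g (ball z r) ∧ ∀ w ∈ ball z r, V w = ‖g w‖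

namespace IsModulusOn

variable {V : ℂ → ℝ} {U : Set ℂ}

lemma nonneg (hV : IsModulusOn V U) {z : ℂ} (hz : z ∈ U) : 0 ≤ V z := by
  obtain ⟨r, hr, -, g, -, hVg⟩ := hV z hz
  rw [hVg z (mem_ball_self hr)]
  exact norm_nonneg _

lemma continuousOn (hV : IsModulusOn V U) : ContinuousOn V U := by
  intro z hz
  obtain ⟨r, hr, -, g, hg, hVg⟩ := hV z hz
  have hmem := isOpen_ball.mem_nhds (mem_ball_self (x := z) hr)
  refine ((hg.continuousOn.continuousAt hmem).norm.congr ?_).continuousWithinAt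
  filter_upwards [hmem] with w hw using (hVg w hw).symm

lemma of_differentiableOn (hU : IsOpen U) {F : ℂ → ℂ} (hF : DifferentiableOn ℂ F U) :
    IsModulusOn (fun z => ‖F z‖) U := by
  intro z hz
  obtain ⟨r, hr, hrU⟩ := Metric.isOpen_iff.1 hU z hz
  exact ⟨r, hr, hrU, F, hF.mono hrU, fun w _ => rfl⟩

lemma mul_exp (hV : IsModulusOn V U) {u : ℂ → ℝ} (hu : IsHarmonicOn u U) (s : ℝ) :
    IsModulusOn (fun z => V z * Real.exp (s * u z)) U := by
  intro z hz
  obtain ⟨r, hr, hrU, g, hg, hVg⟩ := hV z hz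
  obtain ⟨r', hr', -, f, hf, huf⟩ := hu z hz
  have h1 : ball z (min r r') ⊆ ball z r := ball_subset_ball (min_le_left _ _)
  have h2 : ball z (min r r') ⊆ ball z r' := ball_subset_ball (min_le_right _ _)
  refine ⟨min r r', lt_min hr hr', h1.trans hrU, fun w => g w * exp (s * f w),
    (hg.mono h1).mul ((hf.mono h2).const_mul _).cexp, fun w hw => ?_⟩
  simp only [hVg w (h1 hw), huf w (h2 hw), norm_mul, norm_exp, re_ofReal_mul]

/-- The strong maximum principle for the difference of a modulus and a harmonic function. -/
lemma eventually_eq_of_isLocalMax (hV : IsModulusOn V U) {u : ℂ → ℝ} (hu : IsHarmonicOn u U)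
    {z : ℂ} (hz : z ∈ U) (hmax : IsLocalMax (fun w => V w - u w) z) :
    ∀ᶠ w in 𝓝 z, V w - u w = V z - u z := by
  obtain ⟨r, hr, -, g, hg, hVg⟩ := hV z hz
  obtain ⟨r', hr', -, f, hf, huf⟩ := hu z hz
  have hm := isOpen_ball.mem_nhds (mem_ball_self (x := z) hr)
  have hm' := isOpen_ball.mem_nhds (mem_ball_self (x := z) hr')
  obtain ⟨α, hα, hαg⟩ : ∃ α : ℂ, ‖α‖ = 1 ∧ (α * g z).re = ‖g z‖ := by
    by_cases h0 : g z = 0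
    · exact ⟨1, by simp, by simp [h0]⟩
    · have hn : ‖g z‖ ≠ 0 := norm_ne_zero_iff.2 h0
      refine ⟨(starRingEnd ℂ) (g z) / ‖g z‖, ?_, ?_⟩
      · rw [norm_div, norm_conj, norm_real, norm_norm, div_self hn]
      · rw [div_mul_eq_mul_div, mul_comm, mul_conj, normSq_eq_norm_sq, ← ofReal_div, ofReal_re]
        field_simp
  set F : ℂ → ℂ := fun w => exp (α * g w - f w) with hF
  have hle : ∀ᶠ w in 𝓝 z, (α * g w - f w).re ≤ V w - u w := by
    filter_upwards [hm, hm'] with w hw hw'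
    rw [sub_re, ← huf w hw', hVg w hw]
    have := re_le_norm (α * g w)
    rw [norm_mul, hα, one_mul] at this
    linarith
  have heq : (α * g z - f z).re = V z - u z := by
    rw [sub_re, hαg, huf z (mem_ball_self hr'), hVg z (mem_ball_self hr)]
  have hFmax : IsLocalMax (norm ∘ F) z := by
    filter_upwards [hle, hmax] with w hw hw'
    simp only [Function.comp_apply, hF, norm_exp, Real.exp_le_exp]
    linarith
  have hd : ∀ᶠ w in 𝓝 z, DifferentiableAt ℂ F w := by
    filter_upwards [hm, hm'] with w hw hw'
    exact (((hg.differentiableAt (isOpen_ball.mem_nhds hw)).const_mul α).sub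
      (hf.differentiableAt (isOpen_ball.mem_nhds hw'))).cexp
  filter_upwards [eventually_eq_of_isLocalMax_norm hd hFmax, hle, hmax] with w hw hw' hw''
  have h1 : ‖F w‖ = ‖F z‖ := by rw [hw]
  simp only [hF, norm_exp, Real.exp_eq_exp] at h1
  linarith

end IsModulusOn

namespace MCDomain

variable (D : MCDomain n)

lemma continuous_bdist : Continuous D.bdist := continuous_infDist_pt _

lemma mem_of_bdist_pos {z : ℂ} (hz : 0 < D.bdist z) : z ∈ D.Ω := by
  by_contra h
  have : D.bdist z = 0 := infDist_zero_of_mem h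
  linarith

lemma isCompact_bdist_ge {ρ : ℝ} (hρ : 0 < ρ) : IsCompact {z | ρ ≤ D.bdist z} := by
  refine Metric.isCompact_of_isClosed_isBounded (isClosed_le continuous_const D.continuous_bdist)
    (D.bdd.subset fun z hz => D.mem_of_bdist_pos (hρ.trans_le hz))

lemma exists_bdist_lt {ρ : ℝ} (hρ : 0 < ρ) : ∃ z ∈ D.Ω, D.bdist z < ρ := by
  obtain ⟨ζ, hζ, -⟩ := D.exists_frontier_dist_eq D.base_mem
  obtain ⟨z, hz, hzζ⟩ := Metric.mem_closure_iff.1 (frontier_subset_closure hζ) ρ hρ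
  refine ⟨z, hz, (D.bdist_le hζ).trans_lt ?_⟩
  rwa [dist_comm, dist_eq_norm] at hzζ

/-- The maximum principle on a superlevel set of the distance to the boundary. -/
lemma le_of_le_on_bdist_eq {V u : ℂ → ℝ} (hV : IsModulusOn V D.Ω) (hu : IsHarmonicOn u D.Ω)
    {ρ κ : ℝ} (hρ : 0 < ρ) (h : ∀ b, D.bdist b = ρ → V b ≤ u b + κ) {w : ℂ}
    (hw : ρ ≤ D.bdist w) : V w ≤ u w + κ := by
  by_contra hcon
  have hK := D.isCompact_bdist_ge hρ
  have hKΩ : {z | ρ ≤ D.bdist z} ⊆ D.Ω := fun z hz => D.mem_of_bdist_pos (hρ.trans_le hz)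
  have hcont : ContinuousOn (fun z => V z - u z) D.Ω := hV.continuousOn.sub hu.continuousOn
  obtain ⟨z₀, hz₀, hmax⟩ := hK.exists_isMaxOn ⟨w, hw⟩ (hcont.mono hKΩ)
  set m := V z₀ - u z₀ with hm
  have hmκ : κ < m := by
    have : V w - u w ≤ m := hmax hw
    linarith
  have hne : ∀ z, V z - u z = m → D.bdist z ≠ ρ := by
    intro z hz h1
    linarith [h z h1]
  set S : Set ℂ := {z | ρ < D.bdist z ∧ V z - u z = m} with hS
  have hopen : IsOpen S := by
    rw [isOpen_iff_mem_nhds]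
    rintro z ⟨hz1, hz2⟩
    have hnear : ∀ᶠ w in 𝓝 z, ρ < D.bdist w :=
      (isOpen_lt continuous_const D.continuous_bdist).mem_nhds hz1
    have hzmax : IsLocalMax (fun w => V w - u w) z := by
      filter_upwards [hnear] with w hw
      rw [hz2]
      exact hmax hw.le
    filter_upwards [hnear, hV.eventually_eq_of_isLocalMax hu (hKΩ hz1.le) hzmax] with w h1 h2
    exact ⟨h1, h2.trans hz2⟩
  have hz₀S : z₀ ∈ S := ⟨lt_of_le_of_ne hz₀ (Ne.symm (hne z₀ rfl)), rfl⟩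
  have hsub := D.conn.isPreconnected.subset_of_closure_inter_subset hopen
    ⟨z₀, hKΩ hz₀, hz₀S⟩ ?_
  · obtain ⟨z, hz, hzρ⟩ := D.exists_bdist_lt hρ
    exact lt_asymm hzρ (hsub hz).1
  · rintro z ⟨hzc, hzΩ⟩
    have h1 : ρ ≤ D.bdist z :=
      closure_minimal (fun x hx => hx.1.le) (isClosed_le continuous_const D.continuous_bdist) hzc
    have h2 : V z - u z = m := by
      have hne' : (𝓝[S] z).NeBot := mem_closure_iff_nhdsWithin_neBot.1 hzc
      have ht : Tendsto (fun z => V z - u z) (𝓝[S] z) (𝓝 (V z - u z)) :=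
        (hcont.continuousAt (D.isOpen.mem_nhds hzΩ)).mono_left nhdsWithin_le_nhds
      refine tendsto_nhds_unique ht (tendsto_const_nhds.congr' ?_)
      filter_upwards [self_mem_nhdsWithin] with x hx using hx.2.symm
    exact ⟨lt_of_le_of_ne h1 (Ne.symm (hne z h2)), h2⟩

/-- The nontangential upper limit of `V` at `ζ` is at most `c`. -/
def NTLe (V : ℂ → ℝ) (ζ : ℂ) (c : ℝ) : Prop :=
  ∀ a : ℝ, 1 < a → ∀ δ > 0, ∀ᶠ z in 𝓝[{z ∈ D.Ω | ‖z - ζ‖ < a * infDist z D.Ωᶜ}] ζ, V z ≤ c + δ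

lemma tendsto_integral_min_infDist {w : ℂ} (hw : w ∈ D.Ω) {E : Set ℂ} (hE : IsClosed E)
    (hne : E.Nonempty) :
    Tendsto (fun m : ℕ => ∫ ζ, min 1 (m * infDist ζ E) ∂D.ωm w) atTop (𝓝 ((D.ωm w).real Eᶜ)) := by
  have := D.prob w hw
  rw [← integral_indicator_one hE.measurableSet.compl]
  have hc : ∀ m : ℕ, Continuous fun ζ => min 1 (m * infDist ζ E) := fun m =>
    continuous_const.min (continuous_const.mul (continuous_infDist_pt E))
  refine tendsto_integral_of_dominated_convergence (fun _ => 1)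
    (fun m => (hc m).aestronglyMeasurable) (integrable_const _) (fun m => .of_forall fun ζ => ?_)
    (.of_forall fun ζ => ?_)
  · have h0 : (0 : ℝ) ≤ m * infDist ζ E := mul_nonneg (Nat.cast_nonneg _) infDist_nonneg
    rw [Real.norm_of_nonneg (le_min zero_le_one h0)]
    exact min_le_left _ _
  · by_cases hζ : ζ ∈ E
    · rw [indicator_of_notMem (by simpa using hζ)]
      simp [infDist_zero_of_mem hζ]
    · rw [indicator_of_mem (by simpa using hζ)]
      have hpos := (hE.notMem_iff_infDist_pos hne).1 hζ
      refine tendsto_const_nhds.congr' ?_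
      have h1 : Tendsto (fun m : ℕ => m * infDist ζ E) atTop atTop :=
        tendsto_natCast_atTop_atTop.atTop_mul_const hpos
      filter_upwards [h1.eventually_ge_atTop 1] with m hm
      rw [min_eq_left hm, Pi.one_apply]

end MCDomain

namespace MCDomain

variable (D : MCDomain n)

/-- Boundary points at which the bound `V ≤ g + δ` holds in a cone truncated at height
`1 / (k + 1)`. -/
def coneBound (V g : ℂ → ℝ) (a δ : ℝ) (k : ℕ) : Set ℂ :=
  {ζ | ∀ z ∈ D.Ω, ‖z - ζ‖ < a * D.bdist z → ‖z - ζ‖ < 1 / ((k : ℝ) + 1) → V z ≤ g ζ + δ}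

lemma isClosed_coneBound {V g : ℂ → ℝ} (hg : Continuous g) (a δ : ℝ) (k : ℕ) :
    IsClosed (D.coneBound V g a δ k) := by
  have : D.coneBound V g a δ k = ⋂ z ∈ D.Ω, ({ζ | a * D.bdist z ≤ ‖z - ζ‖} ∪
      {ζ | 1 / ((k : ℝ) + 1) ≤ ‖z - ζ‖} ∪ {ζ | V z ≤ g ζ + δ}) := by
    ext ζ
    simp only [coneBound, mem_ofPred_eq, mem_iInter, mem_union]
    refine forall₂_congr fun z _ => ?_
    simp only [imp_iff_not_or, not_lt, or_assoc]
  rw [this]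
  refine isClosed_biInter fun z _ => ((isClosed_le ?_ ?_).union (isClosed_le ?_ ?_)).union
    (isClosed_le ?_ ?_) <;> fun_prop

lemma coneBound_mono {V g : ℂ → ℝ} (a δ : ℝ) : Monotone (D.coneBound V g a δ) := by
  intro k l hkl ζ hζ z hz h1 h2
  refine hζ z hz h1 (h2.trans_le ?_)
  gcongr

lemma NTLe.exists_mem_coneBound {V g : ℂ → ℝ} {ζ : ℂ} (h : D.NTLe V ζ (g ζ)) {a δ : ℝ} (ha : 1 < a)
    (hδ : 0 < δ) : ∃ k, ζ ∈ D.coneBound V g a δ k := by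
  have := h a ha δ hδ
  rw [eventually_nhdsWithin_iff, Metric.eventually_nhds_iff] at this
  obtain ⟨ε, hε, hball⟩ := this
  obtain ⟨k, hk⟩ := exists_nat_one_div_lt hε
  refine ⟨k, fun z hz h1 h2 => hball ?_ ⟨hz, h1⟩⟩
  rw [dist_eq_norm]
  exact h2.trans hk

/-- Near the boundary, a bounded modulus is controlled by the harmonic measure of the bad set. -/
lemma le_integral_add_of_bdist_lt {V g : ℂ → ℝ} {M a δ η r : ℝ} {k : ℕ} (hM : 0 ≤ M)
    (hδ : 0 ≤ δ)
    (hVM : ∀ z ∈ D.Ω, V z ≤ M) (hg : Continuous g) (hg0 : ∀ ζ, 0 ≤ g ζ)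
    (htail : ∀ b ∈ D.Ω, D.bdist b < r →
      (D.ωm b).real {ζ | ζ ∈ frontier D.Ω ∧ a * D.bdist b ≤ ‖b - ζ‖} ≤ η)
    {E : Set ℂ} (hE : IsClosed E) (hEk : E ∩ frontier D.Ω ⊆ D.coneBound V g a δ k) {b : ℂ}
    (hb : b ∈ D.Ω) (hbr : D.bdist b < r) (hbk : a * D.bdist b < 1 / ((k : ℝ) + 1)) :
    V b ≤ (∫ ζ, g ζ ∂D.ωm b) + δ + M * (D.ωm b).real Eᶜ + M * η := by
  have := D.prob b hb
  set T : Set ℂ := {ζ | ζ ∈ frontier D.Ω ∧ a * D.bdist b ≤ ‖b - ζ‖} with hT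
  have hTm : MeasurableSet T := by
    refine (isClosed_frontier.inter (isClosed_le (f := fun _ => a * D.bdist b)
      (g := fun ζ => ‖b - ζ‖) ?_ ?_)).measurableSet <;> fun_prop
  have i1 : Integrable g (D.ωm b) := D.integrable_of_continuousOn hb hg.continuousOn
  have i2 : Integrable (Eᶜ.indicator (fun _ => M)) (D.ωm b) :=
    (integrable_const M).indicator hE.measurableSet.compl
  have i3 : Integrable (T.indicator (fun _ => M)) (D.ωm b) := (integrable_const M).indicator hTm
  have hle : ∀ᵐ ζ ∂D.ωm b,
      V b ≤ g ζ + δ + Eᶜ.indicator (fun _ => M) ζ + T.indicator (fun _ => M) ζ := by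
    filter_upwards [D.ae_mem_frontier hb] with ζ hζ
    have n2 : 0 ≤ Eᶜ.indicator (fun _ => M) ζ := indicator_nonneg (fun _ _ => hM) ζ
    have n3 : 0 ≤ T.indicator (fun _ => M) ζ := indicator_nonneg (fun _ _ => hM) ζ
    by_cases h1 : ζ ∈ T
    · rw [indicator_of_mem h1]
      linarith [hg0 ζ, hVM b hb]
    by_cases h2 : ζ ∈ E
    · have h3 : ‖b - ζ‖ < a * D.bdist b := not_le.1 fun h => h1 ⟨hζ, h⟩
      linarith [hEk ⟨h2, hζ⟩ b hb h3 (h3.trans hbk)]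
    · rw [indicator_of_mem (show ζ ∈ Eᶜ from h2)]
      linarith [hg0 ζ, hVM b hb]
  have i4 : Integrable (fun ζ => g ζ + δ) (D.ωm b) := i1.add (integrable_const δ)
  have i5 : Integrable (fun ζ => g ζ + δ + Eᶜ.indicator (fun _ => M) ζ) (D.ωm b) := i4.add i2
  have hi := integral_mono_ae (integrable_const (V b)) (i5.add i3) hle
  simp only [Pi.add_apply] at hi
  rw [integral_add i5 i3, integral_add i4 i2, integral_add i1 (integrable_const δ),
    integral_indicator_const _ hE.measurableSet.compl, integral_indicator_const _ hTm] at hi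
  simp only [integral_const, probReal_univ, smul_eq_mul] at hi
  nlinarith [htail b hb hbr]

/-- A bounded modulus is at most the integral of any continuous function dominating its
nontangential boundary values, up to the harmonic measure of the exceptional set. -/
lemma le_integral_add_measureReal {V g : ℂ → ℝ} {M : ℝ} (hV : IsModulusOn V D.Ω)
    (hVM : ∀ z ∈ D.Ω, V z ≤ M) (hg : Continuous g) (hg0 : ∀ ζ, 0 ≤ g ζ) {B : Set ℂ}
    (hB : ∀ ζ ∈ frontier D.Ω, ζ ∉ B → D.NTLe V ζ (g ζ)) {w : ℂ} (hw : w ∈ D.Ω) :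
    V w ≤ (∫ ζ, g ζ ∂D.ωm w) + M * (D.ωm w).real B := by
  have hM : 0 ≤ M := (hV.nonneg hw).trans (hVM w hw)
  have := D.prob w hw
  refine le_of_forall_pos_le_add fun θ hθ => ?_
  set δ := θ / (4 + 2 * M) with hδdef
  have hδ : 0 < δ := by positivity
  obtain ⟨a, ha, r, hr, htail⟩ := D.exists_measureReal_far_le hδ
  set E : ℕ → Set ℂ := fun k => insert w (D.coneBound V g a δ k) with hEdef
  have hEc : ∀ k, IsClosed (E k) := fun k =>
    isClosed_singleton.union (D.isClosed_coneBound hg a δ k)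
  have hEmono : Monotone E := fun k l hkl => insert_subset_insert (D.coneBound_mono a δ hkl)
  have hEk : ∀ k, E k ∩ frontier D.Ω ⊆ D.coneBound V g a δ k := by
    rintro k ζ ⟨rfl | h, hζ⟩
    · exact absurd hζ (D.notMem_frontier hw)
    · exact h
  obtain ⟨k, hk⟩ : ∃ k, (D.ωm w).real (E k)ᶜ ≤ (D.ωm w).real B + δ := by
    have hlim : Tendsto (fun k => D.ωm w (E k)ᶜ) atTop (𝓝 (D.ωm w (⋂ k, (E k)ᶜ))) :=
      tendsto_measure_iInter_atTop (fun k => (hEc k).measurableSet.compl.nullMeasurableSet)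
        (fun k l hkl => compl_subset_compl.2 (hEmono hkl)) ⟨0, measure_ne_top _ _⟩
    have hle : D.ωm w (⋂ k, (E k)ᶜ) ≤ D.ωm w B := by
      refine measure_mono_ae ?_
      filter_upwards [D.ae_mem_frontier hw] with ζ hζ hζE
      by_contra hζB
      obtain ⟨k, hk⟩ := (hB ζ hζ hζB).exists_mem_coneBound D ha hδ
      exact (mem_iInter.1 hζE k) (Or.inr hk)
    have hlt : D.ωm w (⋂ k, (E k)ᶜ) < D.ωm w B + ENNReal.ofReal δ :=
      hle.trans_lt (ENNReal.lt_add_right (measure_ne_top _ _) (by simpa using hδ))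
    obtain ⟨k, hk⟩ := (hlim.eventually_lt_const hlt).exists
    refine ⟨k, ?_⟩
    rw [← ENNReal.toReal_ofReal hδ.le, measureReal_def, measureReal_def,
      ← ENNReal.toReal_add (measure_ne_top _ _) ENNReal.ofReal_ne_top]
    exact ENNReal.toReal_mono (by finiteness) hk.le
  set ρ := min (min (r / 2) (1 / ((k : ℝ) + 1) / (2 * a))) (D.bdist w) with hρdef
  have ha0 : 0 < a := by linarith
  have hwd := D.bdist_pos hw
  have hρ : 0 < ρ := by positivity
  have hρr : ρ < r := (min_le_left _ _).trans (min_le_left _ _) |>.trans_lt (half_lt_self hr)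
  have hρk : a * ρ < 1 / ((k : ℝ) + 1) := by
    have h1 : ρ ≤ 1 / ((k : ℝ) + 1) / (2 * a) := (min_le_left _ _).trans (min_le_right _ _)
    have h2 : 0 < 1 / ((k : ℝ) + 1) := by positivity
    calc a * ρ ≤ a * (1 / ((k : ℝ) + 1) / (2 * a)) := by gcongr
      _ = 1 / ((k : ℝ) + 1) / 2 := by field_simp
      _ < _ := half_lt_self h2
  set T : Set ℂ := {b | D.bdist b = ρ} with hT
  have hTΩ : T ⊆ D.Ω := fun b hb => D.mem_of_bdist_pos (hρ.trans_le (le_of_eq hb.symm))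
  have hTc : IsCompact T := (D.isCompact_bdist_ge hρ).of_isClosed_subset
    (isClosed_eq D.continuous_bdist continuous_const) fun b hb => (le_of_eq hb.symm : ρ ≤ _)
  set h : ℕ → ℂ → ℝ := fun m ζ => min 1 (m * infDist ζ (E k)) with hh
  have hhc : ∀ m, Continuous (h m) := fun m =>
    continuous_const.min (continuous_const.mul (continuous_infDist_pt _))
  have hcover : ∀ b ∈ T, ∃ m : ℕ, V b <
      (∫ ζ, g ζ ∂D.ωm b) + M * (∫ ζ, h m ζ ∂D.ωm b) + (2 * δ + M * δ) := by
    intro b hb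
    have h1 := D.le_integral_add_of_bdist_lt hM hδ.le hVM hg hg0 htail (hEc k) (hEk k) (hTΩ hb)
      (by rw [hb]; exact hρr) (by rw [hb]; exact hρk)
    have h2 := ((D.tendsto_integral_min_infDist (hTΩ hb) (hEc k)
      (insert_nonempty _ _)).const_mul M).const_add (∫ ζ, g ζ ∂D.ωm b)
    obtain ⟨m, hm⟩ := (h2.eventually_const_lt (u := (∫ ζ, g ζ ∂D.ωm b) +
      M * (D.ωm b).real (E k)ᶜ - δ) (by linarith)).exists
    exact ⟨m, by simp only [hh]; linarith⟩
  have hmono : ∀ b ∈ D.Ω, Monotone fun m => ∫ ζ, h m ζ ∂D.ωm b := by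
    intro b hb m m' hmm
    refine integral_mono (D.integrable_of_continuousOn hb (hhc m).continuousOn)
      (D.integrable_of_continuousOn hb (hhc m').continuousOn) fun ζ => ?_
    have : infDist ζ (E k) ≥ 0 := infDist_nonneg
    simp only [hh]
    gcongr
  obtain ⟨m, hm⟩ : ∃ m : ℕ, ∀ b ∈ T, V b ≤
      (∫ ζ, g ζ ∂D.ωm b) + M * (∫ ζ, h m ζ ∂D.ωm b) + (2 * δ + M * δ) := by
    set O : ℕ → Set ℂ := fun m => {b | b ∈ D.Ω ∧ V b <
      (∫ ζ, g ζ ∂D.ωm b) + M * (∫ ζ, h m ζ ∂D.ωm b) + (2 * δ + M * δ)} with hO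
    have hOo : ∀ m, IsOpen (O m) := by
      intro m
      have hc : ContinuousOn (fun b => (∫ ζ, g ζ ∂D.ωm b) + M * (∫ ζ, h m ζ ∂D.ωm b) +
          (2 * δ + M * δ) - V b) D.Ω :=
        (((D.continuousOn_integral hg.continuousOn).add (continuousOn_const.mul
          (D.continuousOn_integral (hhc m).continuousOn))).add continuousOn_const).sub
          hV.continuousOn
      have := hc.isOpen_inter_preimage D.isOpen (isOpen_Ioi (a := (0 : ℝ)))
      convert this using 1
      ext b
      simp [hO]
    have hOmono : Monotone O := by
      rintro m m' hmm b ⟨hb, h1⟩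
      refine ⟨hb, h1.trans_le ?_⟩
      have := hmono b hb hmm
      gcongr
    obtain ⟨m, hm⟩ := hTc.elim_directed_cover O hOo
      (fun b hb => mem_iUnion.2 ((hcover b hb).imp fun m hm => ⟨hTΩ hb, hm⟩))
      hOmono.directed_le
    exact ⟨m, fun b hb => (hm hb).2.le⟩
  have hGc : ContinuousOn (fun ζ => g ζ + M * h m ζ) (frontier D.Ω) :=
    (hg.add (continuous_const.mul (hhc m))).continuousOn
  obtain ⟨u, hu, hu', hug⟩ := D.exists_harmonic_approx hGc hδ
  have hGint : ∀ b ∈ D.Ω, ∫ ζ, (g ζ + M * h m ζ) ∂D.ωm b =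
      (∫ ζ, g ζ ∂D.ωm b) + M * ∫ ζ, h m ζ ∂D.ωm b := by
    intro b hb
    rw [integral_add (D.integrable_of_continuousOn hb hg.continuousOn)
      ((D.integrable_of_continuousOn hb (hhc m).continuousOn).const_mul M), integral_const_mul]
  have hfin := D.le_of_le_on_bdist_eq hV hu' (κ := 3 * δ + M * δ) hρ (fun b hb => by
    have h1 := abs_le.1 (D.abs_integral_sub_le hu hu' hGc hug (hTΩ hb))
    rw [hGint b (hTΩ hb)] at h1
    linarith [hm b hb]) (min_le_right _ _ : ρ ≤ D.bdist w)
  have h1 := abs_le.1 (D.abs_integral_sub_le hu hu' hGc hug hw)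
  rw [hGint w hw] at h1
  have h2 : ∫ ζ, h m ζ ∂D.ωm w ≤ (D.ωm w).real (E k)ᶜ :=
    (hmono w hw).ge_of_tendsto (D.tendsto_integral_min_infDist hw (hEc k) (insert_nonempty _ _)) m
  have h3 : δ * (4 + 2 * M) = θ := by rw [hδdef]; field_simp
  nlinarith

end MCDomain

namespace MCDomain

variable (D : MCDomain n)

lemma NTLe.mono_left {V W : ℂ → ℝ} {ζ : ℂ} {p : ℝ} (h : D.NTLe V ζ p)
    (hWV : ∀ z ∈ D.Ω, W z ≤ V z) : D.NTLe W ζ p := by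
  intro a ha δ hδ
  filter_upwards [h a ha δ hδ, self_mem_nhdsWithin] with z hz hzΩ
  exact (hWV z hzΩ.1).trans hz

lemma NTLe.mono_right {V : ℂ → ℝ} {ζ : ℂ} {p q : ℝ} (h : D.NTLe V ζ p) (hpq : p ≤ q) :
    D.NTLe V ζ q := by
  intro a ha δ hδ
  filter_upwards [h a ha δ hδ] with z hz
  linarith

/-- A bounded modulus is at most the harmonic integral of any integrable function dominating its
nontangential boundary values almost everywhere. -/
lemma le_integral_of_bounded {V p : ℂ → ℝ} {M : ℝ} (hV : IsModulusOn V D.Ω)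
    (hVM : ∀ z ∈ D.Ω, V z ≤ M) (hp0 : ∀ ζ, 0 ≤ p ζ) {w : ℂ} (hw : w ∈ D.Ω)
    (hp : Integrable p (D.ωm w)) (hVp : ∀ᵐ ζ ∂D.ωm w, D.NTLe V ζ (p ζ)) :
    V w ≤ ∫ ζ, p ζ ∂D.ωm w := by
  have := D.prob w hw
  have hM : 0 ≤ M := (hV.nonneg hw).trans (hVM w hw)
  refine le_of_forall_pos_le_add fun θ hθ => ?_
  set δ := θ / 3 with hδdef
  have hδ : 0 < δ := by positivity
  set η := min δ (δ * δ / (M + 1)) with hηdef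
  have hη : 0 < η := by positivity
  obtain ⟨g₀, -, hg₀, hg₀c, -⟩ := hp.exists_hasCompactSupport_integral_sub_le hη
  set g : ℂ → ℝ := fun ζ => max (g₀ ζ) 0 with hg
  have hgc : Continuous g := hg₀c.max continuous_const
  have hgi : Integrable g (D.ωm w) := D.integrable_of_continuousOn hw hgc.continuousOn
  have hpg : ∫ ζ, |p ζ - g ζ| ∂D.ωm w ≤ η := by
    refine (integral_mono (hp.sub hgi).abs (hp.sub (D.integrable_of_continuousOn hw
      hg₀c.continuousOn)).norm fun ζ => ?_).trans hg₀
    have h1 := abs_max_sub_max_le_abs (p ζ) (g₀ ζ) 0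
    rwa [max_eq_left (hp0 ζ)] at h1
  set B₁ : Set ℂ := {ζ | ¬ D.NTLe V ζ (p ζ)} with hB₁
  set B₂ : Set ℂ := {ζ | δ ≤ |p ζ - g ζ|} with hB₂
  have hcore := D.le_integral_add_measureReal (g := fun ζ => g ζ + δ) (B := B₁ ∪ B₂) hV hVM
    (hgc.add continuous_const) (fun ζ => by have := le_max_right (g₀ ζ) 0; simp only [hg]; linarith)
    (fun ζ _ hζB => by
      simp only [hB₁, hB₂, mem_union, mem_ofPred_eq, not_or, not_not, not_le] at hζB
      exact hζB.1.mono_right D (by linarith [(abs_lt.1 hζB.2).2])) hw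
  have h1 : (D.ωm w).real B₁ = 0 := by rw [measureReal_def, show D.ωm w B₁ = 0 from hVp]; simp
  have h2 : δ * (D.ωm w).real B₂ ≤ η :=
    (mul_meas_ge_le_integral_of_nonneg (ae_of_all _ fun ζ => abs_nonneg _) (hp.sub hgi).abs
      δ).trans hpg
  have h3 := measureReal_union_le (μ := D.ωm w) B₁ B₂
  have h4 : ∫ ζ, (g ζ + δ) ∂D.ωm w = (∫ ζ, g ζ ∂D.ωm w) + δ := by
    rw [integral_add hgi (integrable_const _)]; simp
  have h5 : ∫ ζ, g ζ ∂D.ωm w ≤ (∫ ζ, p ζ ∂D.ωm w) + η := by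
    have := (abs_integral_le_integral_abs (f := fun ζ => p ζ - g ζ) (μ := D.ωm w)).trans hpg
    rw [integral_sub hp hgi] at this
    linarith [(abs_le.1 this).1]
  have h6 : M * (D.ωm w).real B₂ ≤ δ := by
    have e1 : δ * (D.ωm w).real B₂ ≤ δ * (δ / (M + 1)) :=
      h2.trans ((min_le_right _ _).trans_eq (by ring))
    have e2 := le_of_mul_le_mul_left e1 hδ
    calc M * (D.ωm w).real B₂ ≤ (M + 1) * (δ / (M + 1)) := by gcongr; linarith
      _ = δ := by field_simp
  have h7 : η ≤ δ := min_le_left _ _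
  have h8 : M * (D.ωm w).real (B₁ ∪ B₂) ≤ M * (D.ωm w).real B₂ :=
    mul_le_mul_of_nonneg_left (by linarith) hM
  rw [h4] at hcore
  linarith

/-- A modulus with a harmonic majorant is at most the harmonic integral of any integrable function
dominating its nontangential boundary values almost everywhere. -/
lemma le_integral_of_ntLe {V p u₀ : ℂ → ℝ} (hV : IsModulusOn V D.Ω) (hu₀ : IsHarmonicOn u₀ D.Ω)
    (hVu : ∀ z ∈ D.Ω, V z ≤ u₀ z) (hp0 : ∀ ζ, 0 ≤ p ζ) {w : ℂ} (hw : w ∈ D.Ω)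
    (hp : Integrable p (D.ωm w)) (hVp : ∀ᵐ ζ ∂D.ωm w, D.NTLe V ζ (p ζ)) :
    V w ≤ ∫ ζ, p ζ ∂D.ωm w := by
  have key : ∀ ε > 0, V w * Real.exp (-ε * u₀ w) ≤ ∫ ζ, p ζ ∂D.ωm w := by
    intro ε hε
    have hpos : ∀ z ∈ D.Ω, 0 ≤ u₀ z := fun z hz => (hV.nonneg hz).trans (hVu z hz)
    refine D.le_integral_of_bounded (M := 1 / ε) (hV.mul_exp hu₀ (-ε)) (fun z hz => ?_) hp0 hw hp ?_
    · have h1 : ε * u₀ z ≤ Real.exp (ε * u₀ z) := by linarith [Real.add_one_le_exp (ε * u₀ z)]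
      rw [neg_mul, Real.exp_neg, ← div_eq_mul_inv, div_le_div_iff₀ (Real.exp_pos _) hε]
      nlinarith [hVu z hz]
    · filter_upwards [hVp] with ζ hζ
      refine hζ.mono_left D fun z hz => mul_le_of_le_one_right (hV.nonneg hz) ?_
      rw [Real.exp_le_one_iff]
      nlinarith [hpos z hz]
  have hlim : Tendsto (fun ε : ℝ => V w * Real.exp (-ε * u₀ w)) (𝓝[>] 0) (𝓝 (V w)) := by
    have : Continuous fun ε : ℝ => V w * Real.exp (-ε * u₀ w) := by fun_prop
    simpa using (this.tendsto 0).mono_left (nhdsWithin_le_nhds (s := Ioi 0))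
  exact le_of_tendsto hlim (eventually_nhdsWithin_of_forall key)

end MCDomain

namespace MCDomain

variable (D : MCDomain n)

lemma subset_of_isPreconnected {S : Set ℂ} (hS : IsPreconnected S)
    (hfr : ∀ z ∈ S, z ∉ frontier D.Ω) {z : ℂ} (hz : z ∈ S) (hzΩ : z ∈ D.Ω) : S ⊆ D.Ω := by
  refine hS.subset_left_of_subset_union D.isOpen isClosed_closure.isOpen_compl
    (disjoint_compl_right.mono_left subset_closure) (fun x hx => ?_) ⟨z, hz, hzΩ⟩
  by_cases h : x ∈ closure D.Ω
  · exact Or.inl ((D.mem_or_mem_frontier h).resolve_right (hfr x hx))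
  · exact Or.inr h

lemma hasStrictDerivAt_of_annulusEmbedding {γ : ℂ → ℂ} {r R : ℝ} (hγ : IsAnnulusEmbedding γ r R)
    {τ : ℂ} (hτ : τ ∈ openAnnulus r R) : HasStrictDerivAt γ (deriv γ τ) τ :=
  (hγ.diff.analyticAt ((isOpen_openAnnulus r R).mem_nhds hτ)).hasStrictDerivAt

/-- One of the two sides of a boundary curve is mapped into the domain. -/
lemma exists_side {γ : ℂ → ℂ} {R : ℝ} (hR : 1 < R) (hγ : IsAnnulusEmbedding γ R⁻¹ R)
    (hcirc : γ '' sphere 0 1 ⊆ frontier D.Ω)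
    (hoff : ∀ σ ∈ openAnnulus R⁻¹ R, ‖σ‖ ≠ 1 → γ σ ∉ frontier D.Ω) :
    ∃ κ : ℝ, |κ| = 1 ∧ ∃ s₀ > 0, s₀ < 1 ∧ ∀ s, 0 < s → s < s₀ → ∀ τ : ℂ, ‖τ‖ = 1 →
      ((1 + κ * s : ℝ) : ℂ) * τ ∈ openAnnulus R⁻¹ R ∧ γ (((1 + κ * s : ℝ) : ℂ) * τ) ∈ D.Ω := by
  have hR0 : 0 < R := by linarith
  have hRi : R⁻¹ < 1 := inv_lt_one_of_one_lt₀ hR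
  have h1 : (1 : ℂ) ∈ openAnnulus R⁻¹ R := by simp [openAnnulus, hR, hRi]
  have himg : γ '' openAnnulus R⁻¹ R ∈ 𝓝 (γ 1) := by
    rw [← (hasStrictDerivAt_of_annulusEmbedding hγ h1).map_nhds_eq (hγ.deriv_ne _ h1)]
    exact image_mem_map ((isOpen_openAnnulus _ _).mem_nhds h1)
  obtain ⟨_, ⟨σ, hσ, rfl⟩, hσΩ⟩ := mem_closure_iff_nhds.1
    (frontier_subset_closure (hcirc ⟨1, by simp, rfl⟩)) _ himg
  have hne : ‖σ‖ ≠ 1 := fun h =>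
    D.notMem_frontier hσΩ (hcirc ⟨σ, mem_sphere_zero_iff_norm.2 h, rfl⟩)
  rcases lt_or_gt_of_ne hne with h | h
  · have hsub : openAnnulus R⁻¹ 1 ⊆ openAnnulus R⁻¹ R := openAnnulus_mono le_rfl hR.le
    have := D.subset_of_isPreconnected ((isPreconnected_openAnnulus (R := 1)
      (inv_nonneg.2 hR0.le)).image γ (hγ.diff.continuousOn.mono hsub))
      (by rintro _ ⟨z, hz, rfl⟩; exact hoff z (hsub hz) hz.2.ne) ⟨σ, ⟨hσ.1, h⟩, rfl⟩ hσΩ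
    refine ⟨-1, by simp, 1 - R⁻¹, by linarith, by linarith [inv_pos.2 hR0], fun s hs hs' τ hτ =>
      (fun h => ⟨hsub h, this ⟨_, h, rfl⟩⟩ : _ ∈ openAnnulus R⁻¹ 1 → _) ?_⟩
    rw [openAnnulus, mem_ofPred_eq, norm_mul, norm_real, hτ, Real.norm_eq_abs, mul_one,
      abs_of_pos (by linarith [inv_pos.2 hR0])]
    constructor <;> linarith
  · have hsub : openAnnulus 1 R ⊆ openAnnulus R⁻¹ R := openAnnulus_mono hRi.le le_rfl
    have := D.subset_of_isPreconnected ((isPreconnected_openAnnulus (R := R)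
      zero_le_one).image γ (hγ.diff.continuousOn.mono hsub))
      (by rintro _ ⟨z, hz, rfl⟩; exact hoff z (hsub hz) hz.1.ne') ⟨σ, ⟨h, hσ.2⟩, rfl⟩ hσΩ
    refine ⟨1, by simp, min (R - 1) (1 / 2), lt_min (by linarith) (by norm_num),
      (min_le_right _ _).trans_lt (by norm_num), fun s hs hs' τ hτ =>
      (fun h => ⟨hsub h, this ⟨_, h, rfl⟩⟩ : _ ∈ openAnnulus 1 R → _) ?_⟩
    have hs1 := hs'.trans_le (min_le_left _ _)
    rw [openAnnulus, mem_ofPred_eq, norm_mul, norm_real, hτ, Real.norm_eq_abs, mul_one,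
      abs_of_pos (by linarith)]
    constructor <;> linarith

/-- Transversal approach to a boundary curve stays in a fixed cone. -/
lemma eventually_mem_cone {γ : ℂ → ℂ} {R : ℝ} (hR : 1 < R) (hγ : IsAnnulusEmbedding γ R⁻¹ R)
    (hoff : ∀ σ ∈ openAnnulus R⁻¹ R, ‖σ‖ ≠ 1 → γ σ ∉ frontier D.Ω) {τ : ℂ} (hτ : ‖τ‖ = 1)
    (hτfr : γ τ ∈ frontier D.Ω) :
    ∀ᶠ σ in 𝓝 τ, γ σ ∈ D.Ω → ‖σ - τ‖ = |‖σ‖ - 1| → ‖γ σ - γ τ‖ < 5 * D.bdist (γ σ) := by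
  have hτA : τ ∈ openAnnulus R⁻¹ R := by
    simp [openAnnulus, hτ, hR, inv_lt_one_of_one_lt₀ hR]
  have hd := hasStrictDerivAt_of_annulusEmbedding hγ hτA
  set m := ‖deriv γ τ‖ with hm
  have hm0 : 0 < m := norm_pos_iff.2 (hγ.deriv_ne _ hτA)
  have hlip : ∀ᶠ p : ℂ × ℂ in 𝓝 (τ, τ), ‖γ p.1 - γ p.2 - (p.1 - p.2) * deriv γ τ‖ ≤
      m / 3 * ‖p.1 - p.2‖ := by
    have := hd.hasStrictFDerivAt.isLittleO.def (c := m / 3) (by positivity)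
    simpa using this
  obtain ⟨ε, hε, hball⟩ := Metric.eventually_nhds_iff_ball.1 hlip
  have hU : ball τ ε ∩ openAnnulus R⁻¹ R ∈ 𝓝 τ :=
    inter_mem (ball_mem_nhds τ hε) ((isOpen_openAnnulus _ _).mem_nhds hτA)
  have himg : γ '' (ball τ ε ∩ openAnnulus R⁻¹ R) ∈ 𝓝 (γ τ) := by
    rw [← hd.map_nhds_eq (hγ.deriv_ne _ hτA)]
    exact image_mem_map hU
  obtain ⟨δ, hδ, hδsub⟩ := Metric.mem_nhds_iff.1 himg
  have hcont := hd.hasDerivAt.continuousAt.eventually (ball_mem_nhds (γ τ) (half_pos hδ))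
  filter_upwards [hU, hcont] with σ hσ hσδ hσΩ hσn
  obtain ⟨ζ, hζ, hζd⟩ := D.exists_frontier_dist_eq hσΩ
  rw [dist_eq_norm] at hσδ
  have hζτ : ζ ∈ ball (γ τ) δ := by
    rw [mem_ball, dist_eq_norm]
    have h1 := D.bdist_le (z := γ σ) hτfr
    have h2 := norm_sub_le_norm_sub_add_norm_sub ζ (γ σ) (γ τ)
    rw [norm_sub_rev ζ (γ σ)] at h2
    linarith
  obtain ⟨σ', hσ', rfl⟩ := hδsub hζτ
  have hσ'1 : ‖σ'‖ = 1 := by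
    by_contra h
    exact hoff σ' hσ'.2 h hζ
  have hb : ∀ x y : ℂ, x ∈ ball τ ε → y ∈ ball τ ε → ‖γ x - γ y - (x - y) * deriv γ τ‖ ≤
      m / 3 * ‖x - y‖ := fun x y hx hy => hball (x, y) (by
    rw [← ball_prod_same]; exact ⟨hx, hy⟩)
  have e1 := hb σ σ' hσ.1 hσ'.1
  have e2 := hb σ τ hσ.1 (mem_ball_self hε)
  have f1 : m * ‖σ - σ'‖ ≤ ‖γ σ - γ σ'‖ + m / 3 * ‖σ - σ'‖ := by
    have := norm_sub_le (γ σ - γ σ') (γ σ - γ σ' - (σ - σ') * deriv γ τ)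
    rw [sub_sub_cancel, norm_mul] at this
    linarith
  have f2 : ‖γ σ - γ τ‖ ≤ m * ‖σ - τ‖ + m / 3 * ‖σ - τ‖ := by
    have := norm_add_le ((σ - τ) * deriv γ τ) (γ σ - γ τ - (σ - τ) * deriv γ τ)
    rw [add_sub_cancel, norm_mul] at this
    linarith
  have f3 : ‖σ - τ‖ ≤ ‖σ - σ'‖ := by
    rw [hσn, ← hσ'1]
    exact abs_norm_sub_norm_le σ σ'
  have f4 := D.bdist_pos hσΩ
  rw [hζd] at f1
  nlinarith

/-- Each boundary curve admits a sequence of continuous maps into the domain converging to the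
identity within a fixed cone. -/
lemma exists_approach (j : Fin (n + 1)) :
    ∃ z : ℕ → ℂ → ℂ, (∀ k, ContinuousOn (z k) (D.Γ j)) ∧ (∀ k, ∀ ζ ∈ D.Γ j, z k ζ ∈ D.Ω) ∧
      ∀ ζ ∈ D.Γ j, Tendsto (fun k => z k ζ) atTop
        (𝓝[{z ∈ D.Ω | ‖z - ζ‖ < 5 * infDist z D.Ωᶜ}] ζ) := by
  obtain ⟨γ, R, hR, hγ, him, hoff⟩ := D.exists_annulusEmbedding j
  have hcirc : γ '' sphere 0 1 ⊆ frontier D.Ω := him.subset.trans (D.subset_frontier j)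
  obtain ⟨f, -, hf, -⟩ := D.exists_approxData_zpow j hR hγ him hoff 1
  obtain ⟨κ, hκ, s₀, hs₀, hs₀1, hside⟩ := D.exists_side hR hγ hcirc hoff
  classical
  set ν : ℂ → ℂ := fun ζ => if h : ζ ∈ frontier D.Ω then f ⟨ζ, h⟩ else 0 with hν
  have hνc : ContinuousOn ν (D.Γ j) := by
    refine ContinuousOn.mono ?_ (D.subset_frontier j)
    rw [continuousOn_iff_continuous_domRestrict]
    convert f.continuous using 1
    ext ζ
    simp [hν, domRestrict]
  have hνγ : ∀ τ : ℂ, ‖τ‖ = 1 → ν (γ τ) = τ := by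
    intro τ hτ
    have h : γ τ ∈ frontier D.Ω := hcirc ⟨τ, mem_sphere_zero_iff_norm.2 hτ, rfl⟩
    simp only [hν, h, dite_true]
    rw [hf ⟨γ τ, h⟩ τ hτ rfl, zpow_one]
  set s : ℕ → ℝ := fun k => s₀ / (k + 2) with hs
  have hs_pos : ∀ k, 0 < s k := fun k => by positivity
  have hs_lt : ∀ k, s k < s₀ := fun k => div_lt_self hs₀ (by
    have : (0 : ℝ) ≤ k := k.cast_nonneg
    linarith)
  have hs_lim : Tendsto s atTop (𝓝 0) := by
    refine tendsto_const_nhds.div_atTop ?_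
    exact tendsto_atTop_add_const_right _ _ tendsto_natCast_atTop_atTop
  refine ⟨fun k ζ => γ (((1 + κ * s k : ℝ) : ℂ) * ν ζ), fun k => ?_, fun k ζ hζ => ?_,
    fun ζ hζ => ?_⟩
  · refine hγ.diff.continuousOn.comp (continuousOn_const.mul hνc) fun ζ hζ => ?_
    rw [← him] at hζ
    obtain ⟨τ, hτ, rfl⟩ := hζ
    rw [mem_sphere_zero_iff_norm] at hτ
    rw [hνγ τ hτ]
    exact (hside _ (hs_pos k) (hs_lt k) τ hτ).1
  · rw [← him] at hζ
    obtain ⟨τ, hτ, rfl⟩ := hζ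
    rw [mem_sphere_zero_iff_norm] at hτ
    simp only [hνγ τ hτ]
    exact (hside _ (hs_pos k) (hs_lt k) τ hτ).2
  · rw [← him] at hζ
    obtain ⟨τ, hτ, rfl⟩ := hζ
    have hτfr := hcirc ⟨τ, hτ, rfl⟩
    rw [mem_sphere_zero_iff_norm] at hτ
    have hτA : τ ∈ openAnnulus R⁻¹ R := by
      simp [openAnnulus, hτ, hR, inv_lt_one_of_one_lt₀ hR]
    simp only [hνγ τ hτ]
    have hlim : Tendsto (fun k => ((1 + κ * s k : ℝ) : ℂ) * τ) atTop (𝓝 τ) := by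
      have h1 : Tendsto (fun k => 1 + κ * s k) atTop (𝓝 1) := by
        simpa using (hs_lim.const_mul κ).const_add 1
      simpa using ((continuous_ofReal.tendsto 1).comp h1).mul_const τ
    refine tendsto_nhdsWithin_iff.2 ⟨((hasStrictDerivAt_of_annulusEmbedding hγ
      hτA).hasDerivAt.continuousAt.tendsto.comp hlim), ?_⟩
    filter_upwards [hlim.eventually (D.eventually_mem_cone hR hγ hoff hτ hτfr)] with k hk
    have hΩ := (hside _ (hs_pos k) (hs_lt k) τ hτ).2
    refine ⟨hΩ, hk hΩ ?_⟩
    have hκs : |κ * s k| < 1 := by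
      rw [abs_mul, hκ, one_mul, abs_of_pos (hs_pos k)]
      exact (hs_lt k).trans hs₀1
    have h1 : 0 < 1 + κ * s k := by linarith [(abs_lt.1 hκs).1]
    rw [norm_mul, hτ, mul_one, norm_real, Real.norm_eq_abs, abs_of_pos h1,
      show ((1 + κ * s k : ℝ) : ℂ) * τ - τ = ((κ * s k : ℝ) : ℂ) * τ by push_cast; ring,
      norm_mul, hτ, mul_one, norm_real, Real.norm_eq_abs, add_sub_cancel_left]

end MCDomain

namespace NTLim

variable {Ω : Set ℂ} {F G : ℂ → ℂ} {ζ L K : ℂ}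

lemma add (hF : NTLim Ω F ζ L) (hG : NTLim Ω G ζ K) : NTLim Ω (fun z => F z + G z) ζ (L + K) :=
  fun a ha => (hF a ha).add (hG a ha)

lemma sub (hF : NTLim Ω F ζ L) (hG : NTLim Ω G ζ K) : NTLim Ω (fun z => F z - G z) ζ (L - K) :=
  fun a ha => (hF a ha).sub (hG a ha)

lemma mul (hF : NTLim Ω F ζ L) (hG : NTLim Ω G ζ K) : NTLim Ω (fun z => F z * G z) ζ (L * K) :=
  fun a ha => (hF a ha).mul (hG a ha)

end NTLim

namespace MCDomain

variable (D : MCDomain n)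

lemma isProbabilityMeasure_ω : IsProbabilityMeasure D.ω := D.prob _ D.base_mem

lemma cone_neBot {ζ : ℂ} (hζ : ζ ∈ frontier D.Ω) :
    (𝓝[{z ∈ D.Ω | ‖z - ζ‖ < 5 * infDist z D.Ωᶜ}] ζ).NeBot := by
  rw [D.frontier_eq, mem_iUnion] at hζ
  obtain ⟨j, hj⟩ := hζ
  obtain ⟨z, -, -, hz⟩ := D.exists_approach j
  exact (hz ζ hj).neBot

variable {D} {F G f g : ℂ → ℂ}

lemma ntLe_of_ntLim {ζ L : ℂ} {c : ℝ} (h : NTLim D.Ω F ζ L) (hc : ‖L‖ ≤ c) :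
    D.NTLe (fun z => ‖F z‖) ζ c := by
  intro a ha δ hδ
  exact ((h a ha).norm.eventually_lt_const (u := c + δ) (by linarith)).mono fun z hz => hz.le

/-- Nontangential boundary functions are measurable with respect to harmonic measure. -/
lemma aemeasurable_of_ntLim (hF : ContinuousOn F D.Ω) {w : ℂ} (hw : w ∈ D.Ω)
    (hf : ∀ᵐ ζ ∂D.ωm w, NTLim D.Ω F ζ (f ζ)) : AEMeasurable f (D.ωm w) := by
  rw [← D.restrict_frontier hw, D.frontier_eq, aemeasurable_iUnion_iff]
  intro j
  obtain ⟨z, hzc, hzΩ, hz⟩ := D.exists_approach j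
  have hm : MeasurableSet (D.Γ j) := (D.isCompact_curve j).measurableSet
  refine aemeasurable_of_tendsto_metrizable_ae atTop
    (fun k => (hF.comp (hzc k) (hzΩ k)).aemeasurable hm) ?_
  filter_upwards [ae_restrict_mem hm, ae_restrict_of_ae hf] with ζ hζ hfζ
  exact (hfζ 5 (by norm_num)).comp (hz ζ hζ)

variable (D F f) in
/-- `F` is an analytic function whose modulus has a harmonic majorant and whose nontangential
boundary function is `f`. -/
structure IsHardyExt : Prop where
  diff : DifferentiableOn ℂ F D.Ω
  majorant : ∃ h : ℂ → ℝ, IsHarmonicOn h D.Ω ∧ ∀ z ∈ D.Ω, ‖F z‖ ≤ h z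
  ntLim : ∀ᵐ ζ ∂D.ω, NTLim D.Ω F ζ (f ζ)

lemma ae_norm_le_of_ntLim {M : ℝ} (hF : ∀ z ∈ D.Ω, ‖F z‖ ≤ M)
    (hf : ∀ᵐ ζ ∂D.ω, NTLim D.Ω F ζ (f ζ)) : ∀ᵐ ζ ∂D.ω, ‖f ζ‖ ≤ M := by
  filter_upwards [hf, D.ae_mem_frontier D.base_mem] with ζ hζ hfr
  have := D.cone_neBot hfr
  exact le_of_tendsto (hζ 5 (by norm_num)).norm
    (eventually_nhdsWithin_of_forall fun z hz => hF z hz.1)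

namespace IsHardyExt

lemma of_bounded {M : ℝ} (hF : DifferentiableOn ℂ F D.Ω) (hM : ∀ z ∈ D.Ω, ‖F z‖ ≤ M)
    (hf : ∀ᵐ ζ ∂D.ω, NTLim D.Ω F ζ (f ζ)) : D.IsHardyExt F f :=
  ⟨hF, ⟨fun _ => M, isHarmonicOn_const D.isOpen M, hM⟩, hf⟩

lemma const (c : ℂ) : D.IsHardyExt (fun _ => c) (fun _ => c) :=
  of_bounded (differentiableOn_const c) (fun _ _ => le_rfl)
    (ae_of_all _ fun _ _ _ => tendsto_const_nhds)

lemma add (hF : D.IsHardyExt F f) (hG : D.IsHardyExt G g) :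
    D.IsHardyExt (fun z => F z + G z) (fun ζ => f ζ + g ζ) := by
  obtain ⟨u, hu, hFu⟩ := hF.majorant
  obtain ⟨v, hv, hGv⟩ := hG.majorant
  refine ⟨hF.diff.add hG.diff, ⟨_, hu.add hv, fun z hz =>
    (norm_add_le _ _).trans (add_le_add (hFu z hz) (hGv z hz))⟩, ?_⟩
  filter_upwards [hF.ntLim, hG.ntLim] with ζ h1 h2 using h1.add h2

lemma sub (hF : D.IsHardyExt F f) (hG : D.IsHardyExt G g) :
    D.IsHardyExt (fun z => F z - G z) (fun ζ => f ζ - g ζ) := by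
  obtain ⟨u, hu, hFu⟩ := hF.majorant
  obtain ⟨v, hv, hGv⟩ := hG.majorant
  refine ⟨hF.diff.sub hG.diff, ⟨_, hu.add hv, fun z hz =>
    (norm_sub_le _ _).trans (add_le_add (hFu z hz) (hGv z hz))⟩, ?_⟩
  filter_upwards [hF.ntLim, hG.ntLim] with ζ h1 h2 using h1.sub h2

lemma mul_of_bounded {M : ℝ} (hF : D.IsHardyExt F f) (hM : ∀ z ∈ D.Ω, ‖F z‖ ≤ M)
    (hG : D.IsHardyExt G g) : D.IsHardyExt (fun z => F z * G z) (fun ζ => f ζ * g ζ) := by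
  obtain ⟨v, hv, hGv⟩ := hG.majorant
  have hM0 : 0 ≤ M := (norm_nonneg _).trans (hM _ D.base_mem)
  refine ⟨hF.diff.mul hG.diff, ⟨_, hv.const_mul M, fun z hz => ?_⟩, ?_⟩
  · rw [norm_mul]
    exact mul_le_mul (hM z hz) (hGv z hz) (norm_nonneg _) hM0
  filter_upwards [hF.ntLim, hG.ntLim] with ζ h1 h2 using h1.mul h2

lemma aestronglyMeasurable (hF : D.IsHardyExt F f) : AEStronglyMeasurable f D.ω :=
  (aemeasurable_of_ntLim hF.diff.continuousOn D.base_mem hF.ntLim).aestronglyMeasurable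

lemma norm_le_integral (hF : D.IsHardyExt F f) {p : ℂ → ℝ} (hp0 : ∀ ζ, 0 ≤ p ζ) {w : ℂ}
    (hw : w ∈ D.Ω) (hp : Integrable p (D.ωm w)) (hfp : ∀ᵐ ζ ∂D.ω, ‖f ζ‖ ≤ p ζ) :
    ‖F w‖ ≤ ∫ ζ, p ζ ∂D.ωm w := by
  obtain ⟨u, hu, hFu⟩ := hF.majorant
  refine D.le_integral_of_ntLe (IsModulusOn.of_differentiableOn D.isOpen hF.diff) hu hFu hp0 hw hp ?_
  filter_upwards [(D.absolutelyContinuous hw D.base_mem).ae_le hF.ntLim,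
    (D.absolutelyContinuous hw D.base_mem).ae_le hfp] with ζ h1 h2
  exact ntLe_of_ntLim h1 h2

lemma norm_le_of_ae_norm_le (hF : D.IsHardyExt F f) {M : ℝ} (hM : 0 ≤ M)
    (hf : ∀ᵐ ζ ∂D.ω, ‖f ζ‖ ≤ M) {w : ℂ} (hw : w ∈ D.Ω) : ‖F w‖ ≤ M := by
  have := D.prob w hw
  simpa using hF.norm_le_integral (fun _ => hM) hw (integrable_const M) hf

lemma eq_zero_of_ae_eq_zero (hF : D.IsHardyExt F f) (hf : ∀ᵐ ζ ∂D.ω, f ζ = 0) {w : ℂ}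
    (hw : w ∈ D.Ω) : F w = 0 :=
  norm_le_zero_iff.1 (hF.norm_le_of_ae_norm_le le_rfl (hf.mono fun ζ h => by simp [h]) hw)

lemma ae_eq_zero (hF : D.IsHardyExt F f) (h : ∀ z ∈ D.Ω, F z = 0) : ∀ᵐ ζ ∂D.ω, f ζ = 0 := by
  filter_upwards [ae_norm_le_of_ntLim (M := 0) (fun z hz => by simp [h z hz]) hF.ntLim] with ζ hζ
  exact norm_le_zero_iff.1 hζ

end IsHardyExt

variable (D) in
lemma continuousOn_indicator (j : Fin (n + 1)) :
    ContinuousOn ((D.Γ j).indicator fun _ => (1 : ℝ)) (frontier D.Ω) := by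
  obtain ⟨γ, R, hR, hγ, him, hoff⟩ := D.exists_annulusEmbedding j
  obtain ⟨f, -, hf1, hf0⟩ := D.exists_approxData_zpow j hR hγ him hoff 0
  rw [continuousOn_iff_continuous_domRestrict]
  convert continuous_re.comp f.continuous using 1
  ext ζ
  by_cases h : (ζ : ℂ) ∈ D.Γ j
  · have h' := h
    rw [← him] at h'
    obtain ⟨τ, hτ, hτζ⟩ := h'
    simp [domRestrict, h, hf1 ζ τ (mem_sphere_zero_iff_norm.1 hτ) hτζ]
  · simp [domRestrict, h, hf0 ζ h]

/-- A bounded analytic function with vanishing boundary values on a component of positive harmonic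
measure is zero. -/
lemma eq_zero_of_ae_eq_zero_on_curve {M : ℝ} (hF : DifferentiableOn ℂ F D.Ω)
    (hM : ∀ z ∈ D.Ω, ‖F z‖ ≤ M) (hf : ∀ᵐ ζ ∂D.ω, NTLim D.Ω F ζ (f ζ)) {j : Fin (n + 1)}
    (hj : D.ω (D.Γ j) ≠ 0) (hf0 : ∀ᵐ ζ ∂D.ω, ζ ∈ D.Γ j → f ζ = 0) {w : ℂ} (hw : w ∈ D.Ω) :
    F w = 0 := by
  have hprob := D.prob w hw
  have hM0 : 0 ≤ M := (norm_nonneg _).trans (hM w hw)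
  have hac : D.ωm w ≪ D.ω := D.absolutelyContinuous hw D.base_mem
  have hm : MeasurableSet (D.Γ j) := (D.isCompact_curve j).measurableSet
  have hjw : 0 < (D.ωm w).real (D.Γ j) := by
    rw [measureReal_def, ENNReal.toReal_pos_iff]
    exact ⟨pos_iff_ne_zero.2 fun h => hj (D.absolutelyContinuous D.base_mem hw h),
      measure_lt_top _ _⟩
  set δ := (D.ωm w).real (D.Γ j) / 4 with hδdef
  have hδ : 0 < δ := by positivity
  obtain ⟨q, hqc, hqh, hq⟩ := D.exists_harmonic_approx (D.continuousOn_indicator j) hδ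
  have hqw : 3 * δ ≤ q w := by
    have := abs_le.1 (D.abs_integral_sub_le hqc hqh (D.continuousOn_indicator j) hq hw)
    rw [integral_indicator_const _ hm, smul_eq_mul, mul_one] at this
    linarith
  obtain ⟨Q, hQ⟩ := D.bdd.isCompact_closure.exists_bound_of_continuousOn hqc
  have key : ∀ s : ℝ, 0 < s → ‖F w‖ ≤ M * Real.exp (-(2 * δ) * s) := by
    intro s hs
    have h1 : ‖F w‖ * Real.exp (s * q w) ≤ ∫ _, M * Real.exp (s * δ) ∂D.ωm w := by
      refine D.le_integral_of_bounded (M := M * Real.exp (s * Q))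
        ((IsModulusOn.of_differentiableOn D.isOpen hF).mul_exp hqh s) (fun z hz => ?_)
        (fun _ => by positivity) hw (integrable_const _) ?_
      · have := (le_abs_self _).trans (hQ z (subset_closure hz))
        gcongr
        exact hM z hz
      · filter_upwards [hac.ae_le hf, hac.ae_le hf0, hac.ae_le (ae_norm_le_of_ntLim hM hf),
          D.ae_mem_frontier hw] with ζ h1 h2 h3 h4 a ha ε hε
        have hlim : Tendsto (fun z => ‖F z‖ * Real.exp (s * q z))
            (𝓝[{z ∈ D.Ω | ‖z - ζ‖ < a * infDist z D.Ωᶜ}] ζ)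
            (𝓝 (‖f ζ‖ * Real.exp (s * q ζ))) := by
          have hq' : Tendsto q (𝓝[{z ∈ D.Ω | ‖z - ζ‖ < a * infDist z D.Ωᶜ}] ζ) (𝓝 (q ζ)) :=
            (hqc ζ (frontier_subset_closure h4)).mono_left
              (nhdsWithin_mono _ fun z hz => subset_closure hz.1)
          exact (h1 a ha).norm.mul ((Real.continuous_exp.tendsto _).comp (hq'.const_mul s))
        have hle : ‖f ζ‖ * Real.exp (s * q ζ) ≤ M * Real.exp (s * δ) := by
          by_cases hζ : ζ ∈ D.Γ j
          · rw [h2 hζ, norm_zero, zero_mul]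
            positivity
          · have := hq ζ h4
            rw [indicator_of_notMem hζ, sub_zero] at this
            have := (le_abs_self _).trans this
            gcongr
        exact (hlim.eventually_lt_const (u := M * Real.exp (s * δ) + ε) (by linarith)).mono
          fun z hz => hz.le
    rw [integral_const, probReal_univ, one_smul] at h1
    have h2 : ‖F w‖ * Real.exp (s * (3 * δ)) ≤ M * Real.exp (s * δ) :=
      le_trans (by gcongr) h1
    calc ‖F w‖ = ‖F w‖ * Real.exp (s * (3 * δ)) * Real.exp (-(s * (3 * δ))) := by
          rw [mul_assoc, ← Real.exp_add, add_neg_cancel, Real.exp_zero, mul_one]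
      _ ≤ M * Real.exp (s * δ) * Real.exp (-(s * (3 * δ))) := by gcongr
      _ = M * Real.exp (-(2 * δ) * s) := by rw [mul_assoc, ← Real.exp_add]; ring_nf
  have hlim : Tendsto (fun s : ℝ => M * Real.exp (-(2 * δ) * s)) atTop (𝓝 0) := by
    simpa using (Real.tendsto_exp_atBot.comp
      (tendsto_id.const_mul_atTop_of_neg (by linarith : -(2 * δ) < 0))).const_mul M
  exact norm_le_zero_iff.1 (ge_of_tendsto hlim ((eventually_gt_atTop 0).mono key))

end MCDomain

/-- A quotient of analytic functions that is bounded off the zeros of the denominator extends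
analytically. -/
lemma exists_differentiableOn_quotient {U : Set ℂ} (hU : IsOpen U) (hconn : IsPreconnected U)
    {F G : ℂ → ℂ} (hF : DifferentiableOn ℂ F U) (hG : DifferentiableOn ℂ G U) {M : ℝ}
    (hle : ∀ z ∈ U, ‖F z‖ ≤ M * ‖G z‖) (hne : ∃ z ∈ U, G z ≠ 0) :
    ∃ Q : ℂ → ℂ, DifferentiableOn ℂ Q U ∧ (∀ z ∈ U, ‖Q z‖ ≤ M) ∧
      ∀ z ∈ U, G z ≠ 0 → Q z = F z / G z := by
  set q : ℂ → ℂ := fun z => F z / G z with hq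
  have hqd : ∀ z ∈ U, G z ≠ 0 → DifferentiableAt ℂ q z := fun z hz h =>
    (hF.differentiableAt (hU.mem_nhds hz)).div (hG.differentiableAt (hU.mem_nhds hz)) h
  have hqM : ∀ z ∈ U, G z ≠ 0 → ‖q z‖ ≤ M := fun z hz h => by
    rw [hq, norm_div, div_le_iff₀ (norm_pos_iff.2 h)]
    exact hle z hz
  have hiso : ∀ z ∈ U, ∀ᶠ w in 𝓝[≠] z, G w ≠ 0 := by
    intro z hz
    refine (hG.analyticAt (hU.mem_nhds hz)).eventually_eq_zero_or_eventually_ne_zero.resolve_left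
      fun h => ?_
    obtain ⟨w, hw, hGw⟩ := hne
    exact hGw ((hG.analyticOnNhd hU).eqOn_zero_of_preconnected_of_eventuallyEq_zero hconn hz h hw)
  set Q : ℂ → ℂ := fun z => limUnder (𝓝[≠] z) q with hQ
  have hQq : ∀ z ∈ U, G z ≠ 0 → Q z = q z := fun z hz h =>
    ((hqd z hz h).continuousAt.tendsto.mono_left nhdsWithin_le_nhds).limUnder_eq
  have hQd : ∀ z ∈ U, DifferentiableAt ℂ Q z := by
    intro z hz
    have hev : ∀ᶠ w in 𝓝 z, w ∈ U ∧ (w ≠ z → G w ≠ 0) :=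
      (hU.eventually_mem hz).and (eventually_nhdsWithin_iff.1 (hiso z hz))
    obtain ⟨r, hr, hball⟩ := Metric.eventually_nhds_iff_ball.1 hev
    have hd := differentiableOn_update_limUnder_of_bddAbove (f := q) (ball_mem_nhds z hr)
      (fun w hw => (hqd w (hball w hw.1).1 ((hball w hw.1).2 hw.2)).differentiableWithinAt)
      ⟨M, by
        rintro _ ⟨w, hw, rfl⟩
        exact hqM w (hball w hw.1).1 ((hball w hw.1).2 hw.2)⟩
    refine (hd.differentiableAt (ball_mem_nhds z hr)).congr_of_eventuallyEq ?_
    filter_upwards [ball_mem_nhds z hr] with w hw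
    by_cases h : w = z
    · subst h
      simp [hQ]
    · rw [Function.update_of_ne h, hQq w (hball w hw).1 ((hball w hw).2 h)]
  refine ⟨Q, fun z hz => (hQd z hz).differentiableWithinAt, fun z hz => ?_, hQq⟩
  refine le_of_tendsto ((hQd z hz).continuousAt.norm.tendsto.mono_left
    (nhdsWithin_le_nhds (s := {z}ᶜ))) ?_
  filter_upwards [hiso z hz, nhdsWithin_le_nhds (hU.mem_nhds hz)] with w hw hwU
  rw [hQq w hwU hw]
  exact hqM w hwU hw

namespace MCDomain

variable {D : MCDomain n}

lemma exists_isHardyExt_of_mem_H1 {f : ℂ → ℂ} (hf : f ∈ D.H1) : ∃ F, D.IsHardyExt F f :=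
  let ⟨F, h1, h2, h3⟩ := hf
  ⟨F, h1, h2, h3⟩

lemma IsHardyExt.mem_H1 {F f : ℂ → ℂ} (h : D.IsHardyExt F f) : f ∈ D.H1 :=
  ⟨F, h.diff, h.majorant, h.ntLim⟩

lemma IsInner.exists_ext {φ : ℂ → ℂ} (hφ : D.IsInner φ) :
    ∃ Φ, ∃ M : ℝ, D.IsHardyExt Φ φ ∧ ∀ z ∈ D.Ω, ‖Φ z‖ ≤ M := by
  obtain ⟨Φ, hd, ⟨M, hM⟩, hnt⟩ := hφ.1
  exact ⟨Φ, M, .of_bounded hd hM hnt, hM⟩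

/-- Two inner functions spanning the constants cannot both vanish on a component of positive
harmonic measure. -/
lemma not_both_zero_on_curve {φ ρ : ℂ → ℂ}
    (hgcd : ∀ ε : ℝ, 0 < ε → ∃ c d : ℂ → ℂ,
      eLpNorm (fun x => 1 - (φ x * c x + ρ x * d x)) 1 D.ω < ENNReal.ofReal ε)
    {j : Fin (n + 1)} (hj : D.ω (D.Γ j) ≠ 0) (hφ : ∀ᵐ ζ ∂D.ω, ζ ∈ D.Γ j → φ ζ = 0)
    (hρ : ∀ᵐ ζ ∂D.ω, ζ ∈ D.Γ j → ρ ζ = 0) : False := by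
  have := D.isProbabilityMeasure_ω
  have hm : MeasurableSet (D.Γ j) := (D.isCompact_curve j).measurableSet
  have hfin := measure_ne_top D.ω (D.Γ j)
  obtain ⟨c, d, hcd⟩ := hgcd (D.ω (D.Γ j)).toReal (ENNReal.toReal_pos hj hfin)
  rw [ENNReal.ofReal_toReal hfin, eLpNorm_one_eq_lintegral_enorm] at hcd
  refine hcd.not_ge ?_
  calc D.ω (D.Γ j) = ∫⁻ _ in D.Γ j, 1 ∂D.ω := by simp
    _ = ∫⁻ x in D.Γ j, ‖1 - (φ x * c x + ρ x * d x)‖ₑ ∂D.ω := by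
      refine lintegral_congr_ae ?_
      filter_upwards [ae_restrict_mem hm, ae_restrict_of_ae hφ, ae_restrict_of_ae hρ]
        with ζ h h1 h2
      simp [h1 h, h2 h]
    _ ≤ _ := setLIntegral_le_lintegral _ _

/-- An inner function that does not vanish identically on a component of positive harmonic measure
is bounded below on the boundary. -/
lemma IsInner.exists_pos_le_norm {φ : ℂ → ℂ} (hφ : D.IsInner φ)
    (h : ∀ j, D.ω (D.Γ j) ≠ 0 → ¬ ∀ᵐ ζ ∂D.ω, ζ ∈ D.Γ j → φ ζ = 0) :
    ∃ m : ℝ, 0 < m ∧ ∀ᵐ ζ ∂D.ω, m ≤ ‖φ ζ‖ := by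
  have hj : ∀ j, ∃ m : ℝ, 0 < m ∧ ∀ᵐ ζ ∂D.ω, ζ ∈ D.Γ j → m ≤ ‖φ ζ‖ := by
    intro j
    by_cases h0 : D.ω (D.Γ j) = 0
    · exact ⟨1, one_pos, (measure_eq_zero_iff_ae_notMem.1 h0).mono fun ζ h1 h2 => absurd h2 h1⟩
    obtain ⟨c, hc⟩ := hφ.2 j
    refine ⟨|c|, abs_pos.2 fun hc0 => h j h0 (hc.mono fun ζ h1 h2 => ?_),
      hc.mono fun ζ h1 h2 => ?_⟩
    · exact norm_eq_zero.1 ((h1 h2).trans hc0)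
    · rw [← h1 h2, abs_norm]
  choose m hm hmφ using hj
  obtain ⟨j₀, hj₀⟩ := Finite.exists_min m
  refine ⟨m j₀, hm j₀, ?_⟩
  filter_upwards [ae_all_iff.2 hmφ, D.ae_mem_frontier D.base_mem] with ζ h1 h2
  rw [D.frontier_eq, mem_iUnion] at h2
  obtain ⟨j, hζ⟩ := h2
  exact (hj₀ j).trans (h1 j hζ)

/-- If `ρψ = φh` and `1` is approximable by combinations of `φ` and `ρ`, then the extension of `ψ`
is dominated by that of `φ`. -/
lemma norm_le_mul_norm_of_dvd {φ ρ ψ h Φ P Ψ H : ℂ → ℂ} {Mφ Mρ Mψ m : ℝ}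
    (hΦ : D.IsHardyExt Φ φ) (hΦM : ∀ z ∈ D.Ω, ‖Φ z‖ ≤ Mφ)
    (hP : D.IsHardyExt P ρ) (hPM : ∀ z ∈ D.Ω, ‖P z‖ ≤ Mρ)
    (hΨ : D.IsHardyExt Ψ ψ) (hΨM : ∀ z ∈ D.Ω, ‖Ψ z‖ ≤ Mψ)
    (hH : D.IsHardyExt H h) (hm : 0 < m) (hmφ : ∀ᵐ ζ ∂D.ω, m ≤ ‖φ ζ‖)
    (heq : ∀ᵐ ζ ∂D.ω, ρ ζ * ψ ζ = φ ζ * h ζ)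
    (hgcd : ∀ ε : ℝ, 0 < ε → ∃ c d : ℂ → ℂ, c ∈ D.H1 ∧ d ∈ D.H1 ∧
      eLpNorm (fun x => 1 - (φ x * c x + ρ x * d x)) 1 D.ω < ENNReal.ofReal ε)
    {z : ℂ} (hz : z ∈ D.Ω) : ‖Ψ z‖ ≤ Mψ / m * ‖Φ z‖ := by
  have hMρ : 0 ≤ Mρ := (norm_nonneg _).trans (hPM z hz)
  have hMψ : 0 ≤ Mψ := (norm_nonneg _).trans (hΨM z hz)
  have hφle := ae_norm_le_of_ntLim hΦM hΦ.ntLim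
  have hρle := ae_norm_le_of_ntLim hPM hP.ntLim
  have hψle := ae_norm_le_of_ntLim hΨM hΨ.ntLim
  have hHM : ∀ w ∈ D.Ω, ‖H w‖ ≤ Mρ * Mψ / m := by
    intro w hw
    refine hH.norm_le_of_ae_norm_le (by positivity) ?_ hw
    filter_upwards [hmφ, hρle, hψle, heq] with ζ h1 h2 h3 h4
    rw [le_div_iff₀ hm]
    calc ‖h ζ‖ * m ≤ ‖h ζ‖ * ‖φ ζ‖ := by gcongr
      _ = ‖ρ ζ‖ * ‖ψ ζ‖ := by rw [← norm_mul, ← norm_mul, h4, mul_comm]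
      _ ≤ Mρ * Mψ := by gcongr
  have hPΨ : ∀ w ∈ D.Ω, P w * Ψ w = Φ w * H w := fun w hw =>
    sub_eq_zero.1 (((hP.mul_of_bounded hPM hΨ).sub
      (hΦ.mul_of_bounded hΦM hH)).eq_zero_of_ae_eq_zero (heq.mono fun ζ h => sub_eq_zero.2 h) hw)
  have hprob := D.prob z hz
  have hprob' := D.isProbabilityMeasure_ω
  obtain ⟨A, hA, hAle⟩ := D.exists_measure_le hz D.base_mem
  have key : ∀ ε : ℝ, 0 < ε →
      ‖Ψ z‖ ≤ Mψ / m * (1 + A.toReal * ε) * ‖Φ z‖ + Mψ * (A.toReal * ε) := by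
    intro ε hε
    obtain ⟨c, d, hc, hd, hcd⟩ := hgcd ε hε
    obtain ⟨C, hC⟩ := exists_isHardyExt_of_mem_H1 hc
    obtain ⟨E, hE⟩ := exists_isHardyExt_of_mem_H1 hd
    have hR := (IsHardyExt.const (D := D) 1).sub
      ((hΦ.mul_of_bounded hΦM hC).add (hP.mul_of_bounded hPM hE))
    have hG := (hΨ.mul_of_bounded hΨM hC).add (hH.mul_of_bounded hHM hE)
    set e : ℂ → ℝ := fun ζ => ‖1 - (φ ζ * c ζ + ρ ζ * d ζ)‖ with he
    have heω : Integrable e D.ω :=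
      (memLp_one_iff_integrable.1 ⟨hR.aestronglyMeasurable, hcd.trans_le le_top⟩).norm
    have hez : Integrable e (D.ωm z) := heω.of_measure_le_smul hA hAle
    have heε : ∫ ζ, e ζ ∂D.ω ≤ ε := by
      rw [eLpNorm_one_eq_lintegral_enorm] at hcd
      rw [he, integral_norm_eq_lintegral_enorm hR.aestronglyMeasurable]
      exact ENNReal.toReal_le_of_le_ofReal hε.le hcd.le
    have heA : ∫ ζ, e ζ ∂D.ωm z ≤ A.toReal * ε := by
      calc ∫ ζ, e ζ ∂D.ωm z ≤ ∫ ζ, e ζ ∂(A • D.ω) :=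
            integral_mono_measure hAle (ae_of_all _ fun ζ => norm_nonneg _) (heω.smul_measure hA)
        _ = A.toReal * ∫ ζ, e ζ ∂D.ω := by rw [integral_smul_measure, smul_eq_mul]
        _ ≤ _ := by gcongr
    have hRz := (hR.norm_le_integral (fun ζ => norm_nonneg _) hz hez
      (ae_of_all _ fun ζ => le_rfl)).trans heA
    have hGz : ‖Ψ z * C z + H z * E z‖ ≤ Mψ / m * (1 + A.toReal * ε) := by
      have hi : Integrable (fun ζ => Mψ / m * (1 + e ζ)) (D.ωm z) :=
        ((integrable_const 1).add hez).const_mul _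
      refine (hG.norm_le_integral (p := fun ζ => Mψ / m * (1 + e ζ)) (fun ζ => by positivity)
        hz hi ?_).trans ?_
      · filter_upwards [hmφ, hψle, heq] with ζ h1 h2 h3
        rw [div_mul_eq_mul_div, le_div_iff₀ hm]
        calc ‖ψ ζ * c ζ + h ζ * d ζ‖ * m ≤ ‖ψ ζ * c ζ + h ζ * d ζ‖ * ‖φ ζ‖ := by gcongr
          _ = ‖ψ ζ‖ * ‖1 - (1 - (φ ζ * c ζ + ρ ζ * d ζ))‖ := by
            rw [← norm_mul, ← norm_mul]
            congr 1
            linear_combination -(d ζ) * h3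
          _ ≤ Mψ * (1 + e ζ) := by
            gcongr
            exact (norm_sub_le _ _).trans_eq (by simp [he])
      · rw [integral_const_mul, integral_add (integrable_const 1) hez]
        simp only [integral_const, probReal_univ, smul_eq_mul, mul_one]
        gcongr
    have hid : Ψ z = Φ z * (Ψ z * C z + H z * E z) +
        Ψ z * (1 - (Φ z * C z + P z * E z)) := by
      linear_combination (E z) * hPΨ z hz
    calc ‖Ψ z‖ ≤ ‖Φ z‖ * ‖Ψ z * C z + H z * E z‖ + ‖Ψ z‖ * ‖1 - (Φ z * C z + P z * E z)‖ := by
          conv_lhs => rw [hid]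
          rw [← norm_mul, ← norm_mul]
          exact norm_add_le _ _
      _ ≤ ‖Φ z‖ * (Mψ / m * (1 + A.toReal * ε)) + Mψ * (A.toReal * ε) := by
          gcongr
          exact hΨM z hz
      _ = _ := by ring
  have hlim : Tendsto (fun ε : ℝ => Mψ / m * (1 + A.toReal * ε) * ‖Φ z‖ + Mψ * (A.toReal * ε))
      (𝓝[>] 0) (𝓝 (Mψ / m * ‖Φ z‖)) := by
    have : Continuous fun ε : ℝ =>
        Mψ / m * (1 + A.toReal * ε) * ‖Φ z‖ + Mψ * (A.toReal * ε) := by fun_prop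
    simpa using (this.tendsto 0).mono_left (nhdsWithin_le_nhds (s := Ioi 0))
  exact ge_of_tendsto hlim (eventually_nhdsWithin_of_forall key)

/-- If the extension of `ψ` vanishes, then `ψ` is divisible by everything. -/
lemma IsHardyExt.dvd_of_eq_zero {φ ψ Ψ : ℂ → ℂ} (hΨ : D.IsHardyExt Ψ ψ)
    (h0 : ∀ z ∈ D.Ω, Ψ z = 0) : ∃ h ∈ D.H1, ψ =ᵐ[D.ω] fun x => φ x * h x :=
  ⟨_, (IsHardyExt.const (D := D) 0).mem_H1, (hΨ.ae_eq_zero h0).mono fun ζ h => by simp [h]⟩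

/-- If the extension of `ψ` is dominated by that of `φ`, then `φ` divides `ψ`. -/
lemma IsHardyExt.dvd_of_norm_le {φ ψ Φ Ψ : ℂ → ℂ} (hΦ : D.IsHardyExt Φ φ)
    (hΨ : D.IsHardyExt Ψ ψ) {M : ℝ} (hle : ∀ z ∈ D.Ω, ‖Ψ z‖ ≤ M * ‖Φ z‖)
    (hφ : ∀ᵐ ζ ∂D.ω, φ ζ ≠ 0) : ∃ h ∈ D.H1, ψ =ᵐ[D.ω] fun x => φ x * h x := by
  by_cases hne : ∃ z ∈ D.Ω, Φ z ≠ 0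
  · obtain ⟨Q, hQd, hQM, hQ⟩ := exists_differentiableOn_quotient D.isOpen D.conn.isPreconnected
      hΨ.diff hΦ.diff hle hne
    refine ⟨fun ζ => ψ ζ / φ ζ, (IsHardyExt.of_bounded hQd hQM ?_).mem_H1, ?_⟩
    · filter_upwards [hΦ.ntLim, hΨ.ntLim, hφ] with ζ h1 h2 h3 a ha
      refine ((h2 a ha).div (h1 a ha) h3).congr' ?_
      filter_upwards [(h1 a ha).eventually_ne h3, self_mem_nhdsWithin] with z hz hzΩ
      exact (hQ z hzΩ.1 hz).symm
    · filter_upwards [hφ] with ζ h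
      field_simp
  · push Not at hne
    exact hΨ.dvd_of_eq_zero fun z hz => norm_le_zero_iff.1 (by simpa [hne z hz] using hle z hz)

end MCDomain

/- STATEMENT 18: if φ, ρ, ψ are Royden inner, GCD(φ,ρ) = 1 (the H¹-closure of
φH¹(Ω) + ρH¹(Ω) is H¹(Ω)) and φ divides ρψ (ρψ ∈ φH¹(Ω)), then φ divides ψ. -/
theorem inner_coprime_divides {n : ℕ} (D : MCDomain n)
    (φ ρ ψ : ℂ → ℂ) (hφ : D.IsInner φ) (hρ : D.IsInner ρ) (hψ : D.IsInner ψ)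
    (hgcd : ∀ f : ℂ → ℂ, f ∈ D.H1 → Measurable f → ∀ ε : ℝ, 0 < ε →
      ∃ c d : ℂ → ℂ, c ∈ D.H1 ∧ d ∈ D.H1 ∧ Measurable c ∧ Measurable d ∧
        eLpNorm (fun x => f x - (φ x * c x + ρ x * d x)) 1 D.ω < ENNReal.ofReal ε)
    (hdvd : ∃ h ∈ D.H1, (fun x => ρ x * ψ x) =ᵐ[D.ω] fun x => φ x * h x) :
    ∃ h ∈ D.H1, ψ =ᵐ[D.ω] fun x => φ x * h x := by
  obtain ⟨Φ, Mφ, hΦ, hΦM⟩ := hφ.exists_ext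
  obtain ⟨P, Mρ, hP, hPM⟩ := hρ.exists_ext
  obtain ⟨Ψ, Mψ, hΨ, hΨM⟩ := hψ.exists_ext
  obtain ⟨h, hh, heq⟩ := hdvd
  obtain ⟨H, hH⟩ := MCDomain.exists_isHardyExt_of_mem_H1 hh
  have hone : ∀ ε : ℝ, 0 < ε → ∃ c d : ℂ → ℂ, c ∈ D.H1 ∧ d ∈ D.H1 ∧
      eLpNorm (fun x => 1 - (φ x * c x + ρ x * d x)) 1 D.ω < ENNReal.ofReal ε := by
    intro ε hε
    obtain ⟨c, d, hc, hd, -, -, hcd⟩ := hgcd (fun _ => 1)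
      (MCDomain.IsHardyExt.const (D := D) 1).mem_H1 measurable_const ε hε
    exact ⟨c, d, hc, hd, hcd⟩
  by_cases hz : ∃ j, D.ω (D.Γ j) ≠ 0 ∧ ∀ᵐ ζ ∂D.ω, ζ ∈ D.Γ j → φ ζ = 0
  · obtain ⟨j, hj, hφ0⟩ := hz
    obtain ⟨r, hr⟩ := hρ.2 j
    have hr0 : r ≠ 0 := by
      rintro rfl
      refine MCDomain.not_both_zero_on_curve (fun ε hε => ?_) hj hφ0
        (hr.mono fun ζ h1 h2 => norm_eq_zero.1 (h1 h2))
      obtain ⟨c, d, -, -, hcd⟩ := hone ε hε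
      exact ⟨c, d, hcd⟩
    have hψ0 : ∀ᵐ ζ ∂D.ω, ζ ∈ D.Γ j → ψ ζ = 0 := by
      filter_upwards [hr, hφ0, heq] with ζ h1 h2 h3 hζ
      rw [h2 hζ, zero_mul] at h3
      exact (mul_eq_zero.1 h3).resolve_left fun h4 => hr0 (by rw [← h1 hζ, h4, norm_zero])
    exact hΨ.dvd_of_eq_zero fun z hz =>
      MCDomain.eq_zero_of_ae_eq_zero_on_curve hΨ.diff hΨM hΨ.ntLim hj hψ0 hz
  · obtain ⟨m, hm, hmφ⟩ := hφ.exists_pos_le_norm fun j hj h0 => hz ⟨j, hj, h0⟩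
    exact hΦ.dvd_of_norm_le hΨ (fun z hz => MCDomain.norm_le_mul_norm_of_dvd hΦ hΦM hP hPM hΨ hΨM
      hH hm hmφ heq hone hz) (hmφ.mono fun ζ h1 => norm_pos_iff.1 (hm.trans_le h1))
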